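/- Let η > 0 and δ > 0 satisfy K/(R(d−1)) − (R+1) > δ/η. Then for every μ ∈ ℝ^R the limit J(μ) = lim_{Φ→∞} J(μ, Φ) exists, and there is a constant c depending only on n, R, d, η, δ (not on C̃) such that for all μ ∈ ℝ^R and all Φ > 0: |J(μ) − J(μ, Φ)| ≤ c C̃^{R² − 1 + (R−1)δ/η} Φ^{−1 − δ/η}. -/

import Mathlib

open MeasureTheory Filter MvPolynomial

noncomputable section

/-- `e t = exp (2 π i t)` -/
def eC (t : ℝ) : ℂ := Complex.exp (2 * (Real.pi : ℂ) * Complex.I * (t : ℂ))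

abbrev Qbar : Type := AlgebraicClosure ℚ

/-- Dimension of the affine singular locus of `g` (the common zero set of the partial
derivatives of `g`), as the Krull dimension of its coordinate ring. -/
def singDim (n : ℕ) (g : MvPolynomial (Fin n) Qbar) : WithBot ℕ∞ :=
  ringKrullDim (MvPolynomial (Fin n) Qbar ⧸
    Ideal.span (Set.range fun j : Fin n => MvPolynomial.pderiv j g))

/-- `Δ = max_{b ∈ ℤ^R \ {0}} dim Sing(b₁ g₁ + ⋯ + b_R g_R)`. -/
def birchDelta (n R : ℕ) (g : Fin R → MvPolynomial (Fin n) ℤ) : WithBot ℕ∞ :=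
  ⨆ (b : Fin R → ℤ) (_ : b ≠ 0),
    singDim n (MvPolynomial.map (Int.castRingHom Qbar) (∑ i, b i • g i))

/-- `K = (n - Δ)/2^(d-1)` where `Δ = max_{b ≠ 0} dim Sing(f̃_b)`. -/
def KofDelta (n R d : ℕ) (g : Fin R → MvPolynomial (Fin n) ℤ) (K : ℝ) : Prop :=
  ∃ Δ : ℕ, ((Δ : ℕ∞) : WithBot ℕ∞) = birchDelta n R g ∧
    K = ((n : ℝ) - (Δ : ℝ)) / 2 ^ (d - 1)

/-- The quantity `R(R+1)(d-1)` as a real number. -/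
def BB (R d : ℕ) : ℝ := (R : ℝ) * ((R : ℝ) + 1) * ((d : ℝ) - 1)

/-- The `R × R` minor of the Jacobian matrix of `f` with columns given by the elements
of `I`. -/
def jacMinor {n R : ℕ} (f : Fin R → MvPolynomial (Fin n) ℤ)
    (I : Finset (Fin n)) (hI : I.card = R) : MvPolynomial (Fin n) ℤ :=
  Matrix.det (Matrix.of fun i k : Fin R => MvPolynomial.pderiv (I.orderEmbOfFin hI k) (f i))

/-- `Cv` is the maximum of the absolute values of the coefficients of the `f i`. -/
def coeffMax {n R : ℕ} (f : Fin R → MvPolynomial (Fin n) ℤ) (Cv : ℝ) : Prop :=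
  IsGreatest {x : ℝ | ∃ (i : Fin R) (m : (Fin n) →₀ ℕ), x = |((MvPolynomial.coeff m (f i) : ℤ) : ℝ)|} Cv

/-- The integer points of the dilated box `P𝓑`. -/
def boxPts {n : ℕ} (aB bB : Fin n → ℝ) (P : ℝ) : Finset (Fin n → ℤ) :=
  Finset.Icc (fun j => ⌈P * aB j⌉) (fun j => ⌊P * bB j⌋)

/-- The exponential sum `S(α) = ∑_{x ∈ P𝓑 ∩ ℤ^n} e(α · f(x))`. -/
def Sexp {n R : ℕ} (f : Fin R → MvPolynomial (Fin n) ℤ) (aB bB : Fin n → ℝ) (P : ℝ)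
    (α : Fin R → ℝ) : ℂ :=
  ∑ x ∈ boxPts aB bB P, eC (∑ i, α i * (MvPolynomial.eval x (f i) : ℝ))

/-- The complete exponential sum `S_{a,q} = ∑_{x mod q} e(a · f(x)/q)`. -/
def Sgauss {n R : ℕ} (f : Fin R → MvPolynomial (Fin n) ℤ) (q : ℕ) (a : Fin R → ℤ) : ℂ :=
  ∑ x : Fin n → Fin q,
    eC ((∑ i, (a i : ℝ) * (MvPolynomial.eval (fun j => ((x j : ℕ) : ℤ)) (f i) : ℝ)) / q)

/-- `S_{a,q}(ν) = S_{a,q} e(-a·ν/q)`. -/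
def SgaussNu {n R : ℕ} (f : Fin R → MvPolynomial (Fin n) ℤ) (q : ℕ) (a : Fin R → ℤ)
    (ν : Fin R → ℤ) : ℂ :=
  Sgauss f q a * eC (-(∑ i, (a i : ℝ) * (ν i : ℝ)) / q)

/-- Residues `1 ≤ aᵢ ≤ q` (coded by `Fin q`, shifted by one) with `gcd(a₁, …, a_R, s) = 1`. -/
def resSet (R q s : ℕ) : Finset (Fin R → Fin q) :=
  Finset.univ.filter fun a => Nat.gcd (Finset.univ.gcd fun i => (a i : ℕ) + 1) s = 1

/-- The singular series `𝔖(ν)`. -/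
def singularSeries {n R : ℕ} (f : Fin R → MvPolynomial (Fin n) ℤ) (ν : Fin R → ℤ) : ℂ :=
  ∑' q : ℕ, ((q : ℂ) ^ n)⁻¹ *
    ∑ a ∈ resSet R q q, SgaussNu f q (fun i => ((a i : ℕ) : ℤ) + 1) ν

/-- The local density `𝔖_p(ν)`. -/
def localDensity {n R : ℕ} (f : Fin R → MvPolynomial (Fin n) ℤ) (ν : Fin R → ℤ) (p : ℕ) : ℂ :=
  ∑' r : ℕ, ((p : ℂ) ^ (r * n))⁻¹ *
    ∑ a ∈ resSet R (p ^ r) p, SgaussNu f (p ^ r) (fun i => ((a i : ℕ) : ℤ) + 1) ν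

/-- The box `𝓑 = ∏ⱼ [aⱼ, bⱼ]` as a subset of `ℝ^n`. -/
def boxSet {n : ℕ} (aB bB : Fin n → ℝ) : Set (Fin n → ℝ) :=
  Set.univ.pi fun j => Set.Icc (aB j) (bB j)

/-- The oscillatory integral `I(𝓒, γ) = ∫_{ζ ∈ 𝓒} e(γ · g(ζ)) dζ`. -/
def Iosc {n R : ℕ} (g : Fin R → MvPolynomial (Fin n) ℤ) (C : Set (Fin n → ℝ))
    (γ : Fin R → ℝ) : ℂ :=
  ∫ ζ in C, eC (∑ i, γ i * MvPolynomial.aeval ζ (g i))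

/-- `J(μ, Φ) = ∫_{|γ| ≤ Φ} I(𝓑, γ) e(-γ·μ) dγ`. -/
def Jint {n R : ℕ} (g : Fin R → MvPolynomial (Fin n) ℤ) (aB bB : Fin n → ℝ)
    (μ : Fin R → ℝ) (Φ : ℝ) : ℂ :=
  ∫ γ in {γ : Fin R → ℝ | ∀ i, |γ i| ≤ Φ}, Iosc g (boxSet aB bB) γ * eC (-(∑ i, γ i * μ i))

/-- The singular integral `J(μ) = lim_{Φ → ∞} J(μ, Φ)`. -/
def Jlim {n R : ℕ} (g : Fin R → MvPolynomial (Fin n) ℤ) (aB bB : Fin n → ℝ)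
    (μ : Fin R → ℝ) : ℂ :=
  limUnder Filter.atTop fun Φ : ℝ => Jint g aB bB μ Φ

/-- `M(P, ν)`: the number of integer points `x ∈ P𝓑` with `f(x) = ν`. -/
def Mcount {n R : ℕ} (f : Fin R → MvPolynomial (Fin n) ℤ) (aB bB : Fin n → ℝ) (P : ℝ)
    (ν : Fin R → ℤ) : ℕ :=
  ((boxPts aB bB P).filter fun x => ∀ i, MvPolynomial.eval x (f i) = ν i).card

/-- A single major arc `𝔐_{a,q}(θ)`. -/
def majorArc {R : ℕ} (d : ℕ) (Ct P θ : ℝ) (q : ℕ) (a : Fin R → ℤ) : Set (Fin R → ℝ) :=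
  Set.univ.pi fun i => Set.Icc
    ((a i : ℝ) / q - Ct ^ (R - 1) * P ^ (-(d : ℝ) + (R : ℝ) * ((d : ℝ) - 1) * θ) / (2 * q))
    ((a i : ℝ) / q + Ct ^ (R - 1) * P ^ (-(d : ℝ) + (R : ℝ) * ((d : ℝ) - 1) * θ) / (2 * q))

/-- The major arcs `𝔐(θ)`. -/
def majorArcs (R d : ℕ) (Ct P θ : ℝ) : Set (Fin R → ℝ) :=
  ⋃ (q : ℕ) (_ : 1 ≤ q ∧ (q : ℝ) ≤ Ct ^ R * P ^ ((R : ℝ) * ((d : ℝ) - 1) * θ))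
    (a : Fin R → ℤ)
    (_ : (∀ i, 1 ≤ a i ∧ a i ≤ (q : ℤ)) ∧ Int.gcd (Finset.univ.gcd a) (q : ℤ) = 1),
    majorArc d Ct P θ q a

/-- The minor arcs `𝔪 = [0,1]^R \ 𝔐(θ)`, taken modulo `1`. -/
def minorArcs (R d : ℕ) (Ct P θ : ℝ) : Set (Fin R → ℝ) :=
  {α | (∀ i, 0 ≤ α i ∧ α i ≤ 1) ∧
    ∀ z : Fin R → ℤ, (fun i => α i + (z i : ℝ)) ∉ majorArcs R d Ct P θ}

/-- Nonsingularity of the affine variety `f = 0` over `ℚ̄`: at every common zero the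
Jacobian matrix has (maximal) rank `R`, i.e. some `R × R` minor is nonvanishing. -/
def AffineNonsingular {n : ℕ} (R : ℕ) (f : Fin R → MvPolynomial (Fin n) ℤ) : Prop :=
  ∀ x : Fin n → Qbar, (∀ i, MvPolynomial.aeval x (f i) = 0) →
    ∃ (I : Finset (Fin n)) (hI : I.card = R), MvPolynomial.aeval x (jacMinor f I hI) ≠ 0

/-- Nonsingularity of the projective variety `g = 0` over `ℚ̄` (for forms `g`): at every
nonzero point of the affine cone the Jacobian matrix has rank `R`. -/
def ProjNonsingular {n : ℕ} (R : ℕ) (g : Fin R → MvPolynomial (Fin n) ℤ) : Prop :=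
  ∀ x : Fin n → Qbar, x ≠ 0 → (∀ i, MvPolynomial.aeval x (g i) = 0) →
    ∃ (I : Finset (Fin n)) (hI : I.card = R), MvPolynomial.aeval x (jacMinor g I hI) ≠ 0


section CommAlg

attribute [local instance] MvPolynomial.gradedAlgebra

variable {k : Type*} [Field k] {n : ℕ}

lemma hom_prime_core (I p : Ideal (MvPolynomial (Fin n) k))
    (hI : I.IsHomogeneous (homogeneousSubmodule (Fin n) k)) (hp : p.IsPrime) (hIp : I ≤ p) :
    ∃ q : Ideal (MvPolynomial (Fin n) k), q.IsPrime ∧ I ≤ q ∧ q ≤ p ∧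
      q ≤ RingHom.ker (constantCoeff (R := k) (σ := Fin n)) := by
  refine ⟨(p.homogeneousCore (homogeneousSubmodule (Fin n) k)).toIdeal, hp.homogeneousCore, ?_,
    Ideal.toIdeal_homogeneousCore_le _ _, ?_⟩
  · have := Ideal.homogeneousCore_mono (homogeneousSubmodule (Fin n) k) hIp
    rw [← hI.toIdeal_homogeneousCore_eq_self]
    exact this
  · intro f hf
    have h0 := homogeneousComponent_mem_of_mem
      (p.homogeneousCore (homogeneousSubmodule (Fin n) k)).isHomogeneous hf 0
    rw [homogeneousComponent_zero] at h0
    rw [RingHom.mem_ker]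
    by_contra hne
    have hu : IsUnit (C (coeff 0 f) : MvPolynomial (Fin n) k) := by
      apply IsUnit.map
      exact isUnit_iff_ne_zero.mpr hne
    have := Ideal.eq_top_of_isUnit_mem _ h0 hu
    exact hp.homogeneousCore.ne_top this

lemma hom_exists_pow (I : Ideal (MvPolynomial (Fin n) k))
    (hI : I.IsHomogeneous (homogeneousSubmodule (Fin n) k))
    (hmin : RingHom.ker (constantCoeff (R := k) (σ := Fin n)) ∈ I.minimalPrimes) :
    ∃ N : ℕ, ∀ s : Fin N → Fin n, ∏ l, (X (s l) : MvPolynomial (Fin n) k) ∈ I := by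
  have hrad : RingHom.ker (constantCoeff (R := k) (σ := Fin n)) ≤ I.radical := by
    rw [Ideal.radical_eq_sInf]
    refine le_sInf ?_
    rintro p ⟨hIp, hp⟩
    obtain ⟨q, hq, hIq, hqp, hqm⟩ := hom_prime_core I p hI hp hIp
    exact (hmin.2 ⟨hq, hIq⟩ hqm).trans hqp
  obtain ⟨N, hN⟩ := Ideal.exists_radical_pow_le_of_fg I (IsNoetherian.noetherian _)
  refine ⟨N, fun s => hN ?_⟩
  have : ∏ l : Fin N, (X (s l) : MvPolynomial (Fin n) k) ∈ ∏ _l : Fin N, I.radical := by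
    apply Ideal.prod_mem_prod
    intro l _
    apply hrad
    rw [RingHom.mem_ker]; simp
  simpa using this

/-- a linear form -/
def linForm (a : Fin n → k) : MvPolynomial (Fin n) k := ∑ i, C (a i) * X i

lemma linForm_hom (a : Fin n → k) : (linForm a).IsHomogeneous 1 := by
  unfold linForm
  apply IsHomogeneous.sum
  intro i _
  exact isHomogeneous_C_mul_X _ _

lemma exists_linForm [Infinite k] (I : Ideal (MvPolynomial (Fin n) k))
    (hm : RingHom.ker (constantCoeff (R := k) (σ := Fin n)) ∉ I.minimalPrimes) :
    ∃ a : Fin n → k, ∀ p ∈ I.minimalPrimes, linForm a ∉ p ∨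
      RingHom.ker (constantCoeff (R := k) (σ := Fin n)) < p := by
  classical
  let L : (Fin n → k) →ₗ[k] MvPolynomial (Fin n) k :=
    { toFun := linForm
      map_add' := by intro a b; simp [linForm, add_mul, Finset.sum_add_distrib]
      map_smul' := by intro c a; simp [linForm, Finset.smul_sum, MvPolynomial.smul_eq_C_mul, mul_assoc] }
  have hfin := I.finite_minimalPrimes_of_isNoetherianRing
  let S : Finset (Subspace k (Fin n → k)) :=
    (hfin.toFinset.filter (fun p => ¬ (RingHom.ker (constantCoeff (R := k) (σ := Fin n)) ≤ p))).image
      (fun p => (p.restrictScalars k).comap L)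
  have hS : ⊤ ∉ S := by
    intro h
    simp only [S, Finset.mem_image, Finset.mem_filter] at h
    obtain ⟨p, ⟨_, hp⟩, hp2⟩ := h
    apply hp
    have hX : ∀ i, (X i : MvPolynomial (Fin n) k) ∈ p := by
      intro i
      have : (Pi.single i 1 : Fin n → k) ∈ (p.restrictScalars k).comap L := by rw [hp2]; trivial
      have h2 : linForm (Pi.single i (1:k)) ∈ p := this
      simpa [linForm, Pi.single_apply] using h2
    intro f hf
    rw [RingHom.mem_ker] at hf
    rw [f.as_sum]
    apply Ideal.sum_mem
    intro m hm
    have hm0 : m ≠ 0 := by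
      rintro rfl
      rw [mem_support_iff] at hm
      exact hm hf
    obtain ⟨i, hi⟩ := Finsupp.ne_iff.mp hm0
    rw [monomial_eq]
    apply Ideal.mul_mem_left
    rw [Finsupp.prod]
    apply Ideal.mem_of_dvd _ (Finset.dvd_prod_of_mem _ (Finsupp.mem_support_iff.mpr hi))
    exact Ideal.pow_mem_of_mem _ (hX i) _ (Nat.pos_of_ne_zero hi)
  have := Subspace.biUnion_ne_univ_of_top_notMem hS
  obtain ⟨a, ha⟩ := (Set.ne_univ_iff_exists_notMem _).mp this
  refine ⟨a, fun p hp => ?_⟩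
  by_cases hle : RingHom.ker (constantCoeff (R := k) (σ := Fin n)) ≤ p
  · right
    refine lt_of_le_of_ne hle ?_
    rintro rfl
    exact hm hp
  · left
    intro hap
    apply ha
    simp only [Set.mem_iUnion]
    refine ⟨(p.restrictScalars k).comap L, ?_, hap⟩
    simp only [S, Finset.mem_image, Finset.mem_filter]
    exact ⟨p, ⟨by simpa using hp, hle⟩, rfl⟩

lemma dim_drop (I : Ideal (MvPolynomial (Fin n) k)) (r : MvPolynomial (Fin n) k)
    (hr : ∀ p ∈ I.minimalPrimes, r ∉ p) (hne : I ⊔ Ideal.span {r} ≠ ⊤) :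
    ringKrullDim (MvPolynomial (Fin n) k ⧸ (I ⊔ Ideal.span {r})) + 1 ≤
      ringKrullDim (MvPolynomial (Fin n) k ⧸ I) := by
  set J := I ⊔ Ideal.span {r} with hJ
  have : Nonempty (PrimeSpectrum.zeroLocus (R := MvPolynomial (Fin n) k) J) := by
    rwa [Set.nonempty_coe_sort, Set.nonempty_iff_ne_empty, ne_eq,
      PrimeSpectrum.zeroLocus_empty_iff_eq_top]
  have : Nonempty (PrimeSpectrum.zeroLocus (R := MvPolynomial (Fin n) k) I) := by
    rw [Set.nonempty_coe_sort, Set.nonempty_iff_ne_empty, ne_eq,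
      PrimeSpectrum.zeroLocus_empty_iff_eq_top]
    intro h
    exact hne (by rw [hJ, h, top_sup_eq])
  rw [ringKrullDim_quotient, Order.krullDim_eq_iSup_length, ringKrullDim_quotient,
    Order.krullDim_eq_iSup_length, ← WithBot.coe_one, ← WithBot.coe_add,
    ENat.iSup_add, WithBot.coe_le_coe, iSup_le_iff]
  intro l
  have hl : J ≤ l.head.1.asIdeal := l.head.2
  have hIJ : I ≤ J := le_sup_left
  obtain ⟨p, hp, hp'⟩ := Ideal.exists_minimalPrimes_le (J := l.head.1.asIdeal) (hIJ.trans hl)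
  let p' : PrimeSpectrum.zeroLocus (R := MvPolynomial (Fin n) k) I := ⟨⟨p, hp.1.1⟩, hp.1.2⟩
  let g : PrimeSpectrum.zeroLocus (R := MvPolynomial (Fin n) k) J →
    PrimeSpectrum.zeroLocus (R := MvPolynomial (Fin n) k) I :=
    fun q => ⟨q.1, fun x hx => q.2 (hIJ hx)⟩
  have hrJ : r ∈ J := (le_sup_right : Ideal.span {r} ≤ J) (Ideal.mem_span_singleton_self r)
  have hp'' : p' < g l.head := by
    refine lt_of_le_of_ne hp' fun h ↦ hr p hp ?_
    have : p = l.head.1.asIdeal := congrArg (fun q => q.1.asIdeal) h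
    rw [this]
    exact hl hrJ
  have hgm : StrictMono g := fun _ _ h ↦ h
  refine le_trans ?_ (le_iSup _ ((l.map g hgm).cons p' hp''))
  have hlen : (RelSeries.cons (l.map g hgm) p' hp'').length = l.length + 1 := by
    exact RelSeries.cons_length _ _ _
  rw [hlen]
  push_cast
  exact le_rfl

lemma exists_linForms [Infinite k] (D : ℕ) : ∀ (I : Ideal (MvPolynomial (Fin n) k)),
    I.IsHomogeneous (homogeneousSubmodule (Fin n) k) →
    I ≤ RingHom.ker (constantCoeff (R := k) (σ := Fin n)) →
    ringKrullDim (MvPolynomial (Fin n) k ⧸ I) ≤ (D : WithBot ℕ∞) →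
    ∃ (a : Fin D → Fin n → k) (N : ℕ), ∀ s : Fin N → Fin n,
      ∏ l, (X (s l) : MvPolynomial (Fin n) k) ∈ I ⊔ Ideal.span (Set.range fun i => linForm (a i)) := by
  induction D with
  | zero =>
    intro I hI hIm hdim
    have hmp : (RingHom.ker (constantCoeff (R := k) (σ := Fin n))).IsPrime := RingHom.ker_isPrime _
    obtain ⟨p, hp, hpm⟩ := Ideal.exists_minimalPrimes_le hIm
    have hmin : RingHom.ker (constantCoeff (R := k) (σ := Fin n)) ∈ I.minimalPrimes := by
      by_contra hm
      have hlt : p < RingHom.ker (constantCoeff (R := k) (σ := Fin n)) :=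
        lt_of_le_of_ne hpm (by rintro rfl; exact hm hp)
      rw [ringKrullDim_quotient] at hdim
      let x : PrimeSpectrum.zeroLocus (R := MvPolynomial (Fin n) k) I := ⟨⟨p, hp.1.1⟩, hp.1.2⟩
      let y : PrimeSpectrum.zeroLocus (R := MvPolynomial (Fin n) k) I := ⟨⟨_, hmp⟩, hIm⟩
      have hxy : x < y := hlt
      have := Order.one_le_krullDim_iff.mpr ⟨x, y, hxy⟩
      have h2 := this.trans hdim
      have h3 : ((1 : ℕ) : WithBot ℕ∞) ≤ ((0 : ℕ) : WithBot ℕ∞) := by simpa using h2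
      have h4 : (1 : ℕ) ≤ 0 := by exact_mod_cast h3
      omega
    obtain ⟨N, hN⟩ := hom_exists_pow I hI hmin
    exact ⟨fun i => i.elim0, N, fun s => (le_sup_left : I ≤ _) (hN s)⟩
  | succ D ih =>
    intro I hI hIm hdim
    by_cases hmin : RingHom.ker (constantCoeff (R := k) (σ := Fin n)) ∈ I.minimalPrimes
    · obtain ⟨N, hN⟩ := hom_exists_pow I hI hmin
      exact ⟨fun i => 0, N, fun s => (le_sup_left : I ≤ _) (hN s)⟩
    · obtain ⟨a, ha⟩ := exists_linForm I hmin
      have ha' : ∀ p ∈ I.minimalPrimes, linForm a ∉ p := by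
        intro p hp
        rcases ha p hp with h | h
        · exact h
        · exfalso
          have hmp : (RingHom.ker (constantCoeff (R := k) (σ := Fin n))).IsPrime :=
            RingHom.ker_isPrime _
          exact absurd (hp.2 ⟨hmp, hIm⟩ h.le) (not_le_of_gt h)
      have hlm : linForm a ∈ RingHom.ker (constantCoeff (R := k) (σ := Fin n)) := by
        rw [RingHom.mem_ker]; simp [linForm]
      have hJm : I ⊔ Ideal.span {linForm a} ≤ RingHom.ker (constantCoeff (R := k) (σ := Fin n)) :=
        sup_le hIm ((Ideal.span_singleton_le_iff_mem _).mpr hlm)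
      have hJh : (I ⊔ Ideal.span {linForm a}).IsHomogeneous (homogeneousSubmodule (Fin n) k) := by
        apply Ideal.IsHomogeneous.sup hI
        apply Ideal.homogeneous_span
        rintro x rfl
        exact ⟨1, linForm_hom a⟩
      have hd := dim_drop I (linForm a) ha' (by
        intro h
        rw [h] at hJm
        have : (1 : MvPolynomial (Fin n) k) ∈ RingHom.ker (constantCoeff (R := k) (σ := Fin n)) :=
          hJm trivial
        simp [RingHom.mem_ker] at this)
      have hd2 := hd.trans hdim
      have hd3 : ringKrullDim (MvPolynomial (Fin n) k ⧸ (I ⊔ Ideal.span {linForm a})) ≤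
          (D : WithBot ℕ∞) := by
        push_cast at hd2
        exact ENat.WithBot.add_le_add_one_right_iff.mp hd2
      obtain ⟨a', N, hN⟩ := ih _ hJh hJm hd3
      refine ⟨Fin.cons a a', N, fun s => ?_⟩
      have hle : I ⊔ Ideal.span {linForm a} ⊔ Ideal.span (Set.range fun i => linForm (a' i)) ≤
          I ⊔ Ideal.span (Set.range fun i => linForm ((Fin.cons a a' : Fin (D+1) → Fin n → k) i)) := by
        refine sup_le (sup_le le_sup_left ?_) ?_
        · refine le_trans ?_ le_sup_right
          rw [Ideal.span_singleton_le_iff_mem]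
          exact Ideal.subset_span ⟨0, by simp⟩
        · refine le_trans ?_ le_sup_right
          apply Ideal.span_mono
          rintro _ ⟨i, rfl⟩
          exact ⟨i.succ, by simp⟩
      exact hle (hN s)

end CommAlg

section Uniform

attribute [local instance] MvPolynomial.gradedAlgebra

lemma monomial_eq_prodX {k σ : Type*} [CommSemiring k] (N : ℕ) : ∀ (β : σ →₀ ℕ), β.degree = N →
    ∃ s : Fin N → σ, (monomial β (1 : k)) = ∏ l, X (s l) := by
  classical
  induction N with
  | zero =>
    intro β hβ
    have : β = 0 := by simpa [Finsupp.degree_eq_zero_iff] using hβ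
    subst this
    exact ⟨fun i => i.elim0, by simp⟩
  | succ N ih =>
    intro β hβ
    have hne : β ≠ 0 := by rintro rfl; simp at hβ
    obtain ⟨i, hi⟩ := Finsupp.ne_iff.mp hne
    have hle : Finsupp.single i 1 ≤ β := by
      rw [Finsupp.single_le_iff]; exact Nat.one_le_iff_ne_zero.mpr hi
    obtain ⟨γ, hγ⟩ := exists_add_of_le hle
    have hdeg : γ.degree = N := by
      rw [hγ, map_add, Finsupp.degree_single] at hβ; omega
    obtain ⟨s, hs⟩ := ih γ hdeg
    refine ⟨Fin.cons i s, ?_⟩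
    rw [Fin.prod_univ_succ]
    simp only [Fin.cons_zero, Fin.cons_succ]
    rw [← hs, hγ, X, monomial_mul, one_mul]

/-- homogeneous form attached to a tensor -/
def tform {k : Type*} [CommSemiring k] {n D : ℕ} (a : (Fin D → Fin n) → k) :
    MvPolynomial (Fin n) k :=
  ∑ s, C (a s) * ∏ l, X (s l)

lemma prodX_hom {k σ : Type*} [CommSemiring k] {N : ℕ} (s : Fin N → σ) :
    (∏ l, X (s l) : MvPolynomial σ k).IsHomogeneous N := by
  have := IsHomogeneous.prod (Finset.univ : Finset (Fin N)) (fun l => (X (s l) : MvPolynomial σ k))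
    (fun _ => 1) (fun i _ => isHomogeneous_X _ _)
  simpa using this

lemma tform_hom {k : Type*} [CommSemiring k] {n D : ℕ} (a : (Fin D → Fin n) → k) :
    (tform a).IsHomogeneous D := by
  unfold tform
  apply IsHomogeneous.sum
  intro s _
  exact (prodX_hom s).C_mul _

variable {k : Type*} [Field k] {n : ℕ} {ι : Type*} [Fintype ι]

/-- all monomials of degree `N` are in the ideal generated by the forms -/
def GoodN (D : ι → ℕ) (N : ℕ) (a : (Σ i, (Fin (D i) → Fin n)) → k) : Prop :=
  ∀ s : Fin N → Fin n, ∏ l, (X (s l) : MvPolynomial (Fin n) k) ∈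
    Ideal.span (Set.range fun i => tform (fun s => a ⟨i, s⟩))

lemma GoodN.succ {D : ι → ℕ} {N : ℕ} {a : (Σ i, (Fin (D i) → Fin n)) → k} (h : GoodN D N a) :
    GoodN D (N+1) a := by
  intro s
  rw [Fin.prod_univ_succ]
  exact Ideal.mul_mem_left _ _ (h _)

lemma GoodN.mono {D : ι → ℕ} {N M : ℕ} {a : (Σ i, (Fin (D i) → Fin n)) → k} (h : GoodN D N a)
    (hNM : N ≤ M) : GoodN D M a := by
  induction M, hNM using Nat.le_induction with
  | base => exact h
  | succ M _ ih => exact ih.succ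

lemma GoodN.nearby {D : ι → ℕ} {N : ℕ} {a : (Σ i, (Fin (D i) → Fin n)) → k} (h : GoodN D N a) :
    ∃ c : MvPolynomial (Σ i, (Fin (D i) → Fin n)) k, eval a c ≠ 0 ∧
      ∀ a', eval a' c ≠ 0 → GoodN D N a' := by
  classical
  let S : Finset (Fin n →₀ ℕ) := (Finset.univ : Finset (Fin n)).finsuppAntidiag N
  have hS : ∀ β, β ∈ S ↔ β.degree = N := by
    intro β
    simp [S, Finset.mem_finsuppAntidiag, Finsupp.degree_eq_sum]
  have hmon : ∀ β : S, (monomial β.1 (1:k)) ∈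
      Ideal.span (Set.range fun i => tform (fun s => a ⟨i, s⟩)) := by
    intro β
    obtain ⟨s, hs⟩ := monomial_eq_prodX (k := k) N β.1 ((hS _).mp β.2)
    rw [hs]; exact h s
  have hex : ∀ β : S, ∃ c : ι → MvPolynomial (Fin n) k,
      ∑ i, c i * tform (fun s => a ⟨i, s⟩) = monomial β.1 (1:k) := by
    intro β
    exact Ideal.mem_span_range_iff_exists_fun.mp (hmon β)
  choose c hc using hex
  let M : Matrix S S (MvPolynomial (Σ i, (Fin (D i) → Fin n)) k) := fun β β' =>
    ∑ i, ∑ s : Fin (D i) → Fin n, C (coeff β'.1 (c β i * ∏ l, X (s l))) * X ⟨i, s⟩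
  have hM : ∀ a' β β', eval a' (M β β') = coeff β'.1 (∑ i, c β i * tform (fun s => a' ⟨i, s⟩)) := by
    intro a' β β'
    simp only [M, map_sum, map_mul, eval_C, eval_X, coeff_sum]
    apply Finset.sum_congr rfl
    intro i _
    simp only [tform, Finset.mul_sum, coeff_sum]
    apply Finset.sum_congr rfl
    intro s _
    rw [mul_left_comm, coeff_C_mul, mul_comm]
  refine ⟨M.det, ?_, ?_⟩
  · have : (eval a).mapMatrix M = 1 := by
      ext β β'
      rw [RingHom.mapMatrix_apply, Matrix.map_apply, hM, hc, coeff_monomial, Matrix.one_apply]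
      by_cases h : β = β'
      · rw [if_pos h, if_pos (congrArg _ h)]
      · rw [if_neg h, if_neg fun h' => h (Subtype.ext h')]
    rw [RingHom.map_det, this]; simp
  · intro a' ha'
    set I := Ideal.span (Set.range fun i => tform (fun s => a' ⟨i, s⟩)) with hI
    have hIh : I.IsHomogeneous (homogeneousSubmodule (Fin n) k) := by
      apply Ideal.homogeneous_span
      rintro _ ⟨i, rfl⟩
      exact ⟨D i, tform_hom _⟩
    let A : Matrix S S k := (eval a').mapMatrix M
    have hA : A.det ≠ 0 := by
      rw [RingHom.map_det] at ha'; exact ha'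
    have hrow : ∀ β : S, ∑ β' : S, C (A β β') * monomial β'.1 (1:k) ∈ I := by
      intro β
      have h1 : (∑ i, c β i * tform (fun s => a' ⟨i, s⟩)) ∈ I :=
        Ideal.sum_mem _ fun i _ => Ideal.mul_mem_left _ _ (Ideal.subset_span ⟨i, rfl⟩)
      have h2 := homogeneousComponent_mem_of_mem hIh h1 N
      convert h2 using 1
      ext γ
      rw [coeff_homogeneousComponent, coeff_sum]
      simp only [coeff_C_mul, coeff_monomial]
      split_ifs with hγ
      · rw [Finset.sum_eq_single (⟨γ, (hS γ).mpr hγ⟩ : S)]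
        · simp only [if_true, mul_one]
          exact hM a' β ⟨γ, (hS γ).mpr hγ⟩
        · intro β' _ hne
          rw [if_neg, mul_zero]
          intro h; exact hne (Subtype.ext h)
        · simp
      · apply Finset.sum_eq_zero
        intro β' _
        rw [if_neg, mul_zero]
        rintro rfl
        exact hγ ((hS _).mp β'.2)
    have hall : ∀ β : S, monomial β.1 (1:k) ∈ I := by
      intro β
      have h1 : ∑ β'' : S, C (A.adjugate β β'') * (∑ β' : S, C (A β'' β') * monomial β'.1 (1:k)) ∈ I :=
        Ideal.sum_mem _ fun i _ => Ideal.mul_mem_left _ _ (hrow i)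
      have h2 : ∑ β'' : S, C (A.adjugate β β'') * (∑ β' : S, C (A β'' β') * monomial β'.1 (1:k))
          = C A.det * monomial β.1 (1:k) := by
        simp only [Finset.mul_sum]
        rw [Finset.sum_comm]
        have : ∀ β' : S, ∑ β'' : S, C (A.adjugate β β'') * (C (A β'' β') * monomial β'.1 (1:k)) =
            C ((A.adjugate * A) β β') * monomial β'.1 (1:k) := by
          intro β'
          rw [Matrix.mul_apply, map_sum, Finset.sum_mul]
          apply Finset.sum_congr rfl
          intro _ _
          rw [map_mul, mul_assoc]
        simp only [this, Matrix.adjugate_mul]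
        rw [Finset.sum_eq_single β]
        · simp
        · intro b _ hb
          simp [Matrix.one_apply, hb.symm]
        · simp
      rw [h2] at h1
      have h3 := Ideal.mul_mem_left I (C (A.det)⁻¹) h1
      rwa [← mul_assoc, ← map_mul, inv_mul_cancel₀ hA, map_one, one_mul] at h3
    intro s
    have hh := prodX_hom (k := k) s
    rw [(∏ l, X (s l) : MvPolynomial (Fin n) k).as_sum]
    apply Ideal.sum_mem
    intro β hβ
    have hd := hh.degree_eq_sum_deg_support hβ
    have h3 := Ideal.mul_mem_left I (C (coeff β (∏ l, X (s l) : MvPolynomial (Fin n) k)))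
      (hall ⟨β, (hS β).mpr (by first | exact hd.symm | (rw [Finsupp.degree]; exact hd.symm) | simpa using hd.symm)⟩)
    rwa [C_mul_monomial, mul_one] at h3

theorem uniformN (k : Type*) [Field k] (n : ℕ) {ι : Type*} [Fintype ι] (D : ι → ℕ) :
    ∃ N0 : ℕ, ∀ a : (Σ i, (Fin (D i) → Fin n)) → k, (∃ N, GoodN D N a) → GoodN D N0 a := by
  let J : ℕ → Ideal (MvPolynomial (Σ i, (Fin (D i) → Fin n)) k) := fun N =>
    { carrier := {c | ∀ a : (Σ i, (Fin (D i) → Fin n)) → k, ¬ GoodN D N a → eval a c = 0}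
      add_mem' := by
        intro x y hx hy a ha
        rw [map_add, hx a ha, hy a ha, add_zero]
      zero_mem' := by intro a _; simp
      smul_mem' := by
        intro c x hx a ha
        rw [smul_eq_mul, map_mul, hx a ha, mul_zero] }
  have hJ : Monotone J := by
    intro N M hNM c hc a ha
    exact hc a fun h => ha (h.mono hNM)
  obtain ⟨N0, hN0⟩ := monotone_stabilizes_iff_noetherian.mpr
    (inferInstance : IsNoetherian (MvPolynomial (Σ i, (Fin (D i) → Fin n)) k) _) ⟨J, hJ⟩
  refine ⟨N0, fun a ⟨N, hN⟩ => ?_⟩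
  rcases le_total N N0 with h | h
  · exact hN.mono h
  · obtain ⟨c, hca, hc⟩ := hN.nearby
    have hcJ : c ∈ J N := by
      intro a' ha'
      by_contra hne
      exact ha' (hc a' hne)
    have : J N0 = J N := hN0 N h
    rw [← this] at hcJ
    by_contra hbad
    exact hca (hcJ a hbad)

end Uniform

section CountPts

attribute [local instance] MvPolynomial.gradedAlgebra

variable {k : Type*} [Field k] {σ : Type*} [Fintype σ] {e : ℕ}

/-- span of `x^β L^α` with bounded exponents -/
def WW (L : Fin e → MvPolynomial σ k) (N m : ℕ) : Submodule k (MvPolynomial σ k) :=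
  Submodule.span k {p | ∃ (β : σ → ℕ) (α : Fin e → ℕ), (∀ i, β i < N) ∧ (∀ i, α i ≤ m) ∧
    p = (∏ i, X i ^ β i) * ∏ i, L i ^ α i}

lemma WW_mono (L : Fin e → MvPolynomial σ k) (N : ℕ) {m m' : ℕ} (h : m ≤ m') :
    WW L N m ≤ WW L N m' := by
  apply Submodule.span_mono
  rintro p ⟨β, α, hβ, hα, rfl⟩
  exact ⟨β, α, hβ, fun i => (hα i).trans h, rfl⟩

lemma WW_mul (L : Fin e → MvPolynomial σ k) (N m : ℕ) (i : Fin e) {p : MvPolynomial σ k}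
    (hp : p ∈ WW L N m) : L i * p ∈ WW L N (m+1) := by
  classical
  unfold WW at hp
  induction hp using Submodule.span_induction with
  | mem x hx =>
    obtain ⟨β, α, hβ, hα, rfl⟩ := hx
    apply Submodule.subset_span
    refine ⟨β, fun j => α j + if j = i then 1 else 0, hβ, ?_, ?_⟩
    · intro j
      have := hα j
      dsimp only
      split_ifs <;> omega
    · simp only [pow_add, Finset.prod_mul_distrib, pow_ite, pow_one, pow_zero,
        Finset.prod_ite_eq', Finset.mem_univ, if_true]
      ring
  | zero => simp
  | add x y _ _ hx hy => rw [mul_add]; exact Submodule.add_mem _ hx hy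
  | smul a x _ hx => rw [mul_smul_comm]; exact Submodule.smul_mem _ _ hx

lemma hom_mem_of_monomials {S : Submodule k (MvPolynomial σ k)} {m : ℕ}
    (h : ∀ γ : σ →₀ ℕ, γ.degree = m → monomial γ (1:k) ∈ S) {p : MvPolynomial σ k}
    (hp : p.IsHomogeneous m) : p ∈ S := by
  rw [p.as_sum]
  apply Submodule.sum_mem
  intro β hβ
  have hd := hp.degree_eq_sum_deg_support hβ
  have := Submodule.smul_mem S (coeff β p) (h β hd.symm)
  rwa [smul_monomial, smul_eq_mul, mul_one] at this

lemma hom_reduce (I : Ideal (MvPolynomial σ k))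
    (hI : I.IsHomogeneous (homogeneousSubmodule σ k)) (L : Fin e → MvPolynomial σ k)
    (hL : ∀ i, (L i).IsHomogeneous 1) (N : ℕ)
    (hN : ∀ s : Fin N → σ, ∏ l, X (s l) ∈ I ⊔ Ideal.span (Set.range L)) (m : ℕ) :
    ∀ p : MvPolynomial σ k, p.IsHomogeneous m → p ∈ I.restrictScalars k ⊔ WW L N m := by
  classical
  induction m with
  | zero =>
    intro p hp
    apply hom_mem_of_monomials _ hp
    intro γ hγ
    have : γ = 0 := by simpa [Finsupp.degree_eq_zero_iff] using hγ
    subst this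
    rcases Nat.eq_zero_or_pos N with h0 | h0
    · subst h0
      have := hN (fun i => i.elim0)
      simp only [Finset.univ_eq_empty, Finset.prod_empty] at this
      obtain ⟨a, ha, b, hb, hab⟩ := Submodule.mem_sup.mp this
      have hc := congrArg (homogeneousComponent 0) hab
      have hb0 : homogeneousComponent 0 b = 0 := by
        rw [homogeneousComponent_zero]
        have : Ideal.span (Set.range L) ≤ RingHom.ker (constantCoeff (R := k) (σ := σ)) := by
          rw [Ideal.span_le]
          rintro _ ⟨i, rfl⟩
          exact (hL i).coeff_eq_zero (d := 0) (by simp)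
        have h2 := this hb
        have h3 : coeff 0 b = 0 := h2
        rw [h3, map_zero]
      rw [map_add, hb0, add_zero] at hc
      apply Submodule.mem_sup_left
      have h1 := homogeneousComponent_mem_of_mem hI ha 0
      rw [hc] at h1
      have : homogeneousComponent 0 (1 : MvPolynomial σ k) = 1 := by
        simp [homogeneousComponent_zero]
      rw [this] at h1
      exact h1
    · apply Submodule.mem_sup_right
      apply Submodule.subset_span
      exact ⟨0, 0, fun _ => h0, fun _ => le_rfl, by simp⟩
  | succ m ih =>
    intro p hp
    apply hom_mem_of_monomials _ hp
    intro γ hγ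
    by_cases hlt : m + 1 < N
    · apply Submodule.mem_sup_right
      apply Submodule.subset_span
      refine ⟨γ, 0, fun i => ?_, fun i => Nat.zero_le _, ?_⟩
      · exact (Finsupp.le_degree i γ).trans_lt (hγ ▸ hlt)
      · rw [monomial_eq, Finsupp.prod_fintype _ _ (by simp)]; simp
    · push Not at hlt
      obtain ⟨s, hs⟩ := monomial_eq_prodX (k := k) (m+1) γ hγ
      obtain ⟨r, hr⟩ := Nat.exists_eq_add_of_le hlt
      -- split product
      have hsplit : ∃ (s1 : Fin N → σ) (s2 : Fin r → σ),
          (∏ l, X (s l) : MvPolynomial σ k) = (∏ l, X (s1 l)) * ∏ l, X (s2 l) := by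
        revert s
        rw [hr]
        intro s _
        exact ⟨fun l => s (Fin.castAdd r l), fun l => s (Fin.natAdd N l), Fin.prod_univ_add _⟩
      obtain ⟨s1, s2, h12⟩ := hsplit
      obtain ⟨a, ha, b, hb, hab⟩ := Submodule.mem_sup.mp (hN s1)
      obtain ⟨c, rfl⟩ := Ideal.mem_span_range_iff_exists_fun.mp hb
      have hhom := prodX_hom (k := k) s
      have hpq : (∏ l, X (s l) : MvPolynomial σ k) =
          homogeneousComponent (m+1) ((∏ l, X (s2 l)) * a) +
          ∑ i, L i * homogeneousComponent m ((∏ l, X (s2 l)) * c i) := by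
        rw [← homogeneousComponent_of_mem hhom (m := m+1) |>.trans (if_pos rfl), h12, ← hab,
          add_mul, map_add, Finset.sum_mul, map_sum, mul_comm a]
        congr 1
        apply Finset.sum_congr rfl
        intro i _
        have := DirectSum.coe_decompose_mul_of_right_mem_of_le (homogeneousSubmodule σ k)
          (a := (∏ l, X (s2 l)) * c i) (b := L i) (n := m+1) (i := 1) (hL i) (by omega)
        have e1 := decomposition.decompose'_apply ((∏ l, X (s2 l)) * c i * L i) (m+1)
        have e2 := decomposition.decompose'_apply ((∏ l, X (s2 l)) * c i) m
        rw [show c i * L i * ∏ l, X (s2 l) = (∏ l, X (s2 l)) * c i * L i by ring, mul_comm (L i)]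
        rw [← e1, ← e2]
        exact this
      rw [hs, hpq]
      apply Submodule.add_mem
      · apply Submodule.mem_sup_left
        exact homogeneousComponent_mem_of_mem hI (Ideal.mul_mem_left _ _ ha) (m+1)
      · apply Submodule.sum_mem
        intro i _
        have := ih _ (homogeneousComponent_isHomogeneous m ((∏ l, X (s2 l)) * c i))
        obtain ⟨u, hu, v, hv, huv⟩ := Submodule.mem_sup.mp this
        rw [← huv, mul_add]
        apply Submodule.add_mem
        · exact Submodule.mem_sup_left (Ideal.mul_mem_left _ _ hu)
        · exact Submodule.mem_sup_right (WW_mul L N m i hv)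

theorem count_pts (I : Ideal (MvPolynomial σ k))
    (hI : I.IsHomogeneous (homogeneousSubmodule σ k)) (L : Fin e → MvPolynomial σ k)
    (hL : ∀ i, (L i).IsHomogeneous 1) (N : ℕ)
    (hN : ∀ s : Fin N → σ, ∏ l, X (s l) ∈ I ⊔ Ideal.span (Set.range L))
    (Z : Finset (σ → k)) (hZ : ∀ z ∈ Z, ∀ p ∈ I, eval z p = 0)
    (S : Finset k) (t : ℕ) (hS : S.card ≤ t) (hZS : ∀ z ∈ Z, ∀ i, z i ∈ S) :
    Z.card ≤ N ^ Fintype.card σ * (Fintype.card σ * t + 1) ^ e := by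
  classical
  set M := Fintype.card σ * t with hM
  let ev : MvPolynomial σ k →ₗ[k] (Z → k) :=
    { toFun := fun p z => eval z.1 p
      map_add' := by intro p q; ext; simp
      map_smul' := by intro a p; ext; simp [smul_eval] }
  let w : (σ → Fin N) × (Fin e → Fin (M+1)) → (Z → k) := fun x =>
    ev ((∏ i, X i ^ (x.1 i : ℕ)) * ∏ i, L i ^ (x.2 i : ℕ))
  have hdeg : ∀ p : MvPolynomial σ k, p.totalDegree ≤ M → ev p ∈ Submodule.span k (Set.range w) := by
    intro p hp
    rw [← sum_homogeneousComponent p, map_sum]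
    apply Submodule.sum_mem
    intro m hm
    have hmM : m ≤ M := by
      have := Finset.mem_range.mp hm; omega
    have := hom_reduce I hI L hL N hN m _ (homogeneousComponent_isHomogeneous m p)
    obtain ⟨u, hu, v, hv, huv⟩ := Submodule.mem_sup.mp this
    rw [← huv, map_add]
    have hu0 : ev u = 0 := by
      ext z; exact hZ z.1 z.2 u hu
    rw [hu0, zero_add]
    have hv' := WW_mono L N hmM hv
    have hle : (WW L N M) ≤ (Submodule.span k (Set.range w)).comap ev := by
      rw [WW, Submodule.span_le]
      rintro p ⟨β, α, hβ, hα, rfl⟩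
      apply Submodule.subset_span
      exact ⟨(fun i => ⟨β i, hβ i⟩, fun i => ⟨α i, Nat.lt_succ_of_le (hα i)⟩), rfl⟩
    exact hle hv'
  have htop : Submodule.span k (Set.range w) = ⊤ := by
    rw [eq_top_iff]
    intro f _
    -- Lagrange
    let lag : Z → MvPolynomial σ k := fun z =>
      ∏ i, ∏ c ∈ S.erase (z.1 i), (C (z.1 i - c)⁻¹ * (X i - C c))
    have hlag : ∀ z z' : Z, eval z'.1 (lag z) = if z' = z then 1 else 0 := by
      intro z z'
      simp only [lag, map_prod, map_mul, map_sub, eval_C, eval_X]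
      split_ifs with h
      · subst h
        apply Finset.prod_eq_one
        intro i _
        apply Finset.prod_eq_one
        intro c hc
        exact inv_mul_cancel₀ (sub_ne_zero.mpr (Finset.ne_of_mem_erase hc).symm)
      · have : ∃ i, z'.1 i ≠ z.1 i := by
          by_contra hcon
          push Not at hcon
          exact h (Subtype.ext (funext hcon))
        obtain ⟨i, hi⟩ := this
        apply Finset.prod_eq_zero (Finset.mem_univ i)
        apply Finset.prod_eq_zero (Finset.mem_erase.mpr ⟨hi, hZS z'.1 z'.2 i⟩)
        simp
    have hlagdeg : ∀ z, (lag z).totalDegree ≤ M := by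
      intro z
      refine (totalDegree_finsetProd _ _).trans ?_
      rw [hM, ← Finset.card_univ, ← smul_eq_mul]
      apply Finset.sum_le_card_nsmul
      intro i _
      refine (totalDegree_finsetProd _ _).trans ?_
      refine le_trans (Finset.sum_le_card_nsmul _ _ 1 ?_) ?_
      · intro c _
        refine (totalDegree_mul _ _).trans ?_
        rw [totalDegree_C, zero_add]
        refine (totalDegree_sub _ _).trans ?_
        simp [totalDegree_X]
      · rw [smul_eq_mul, mul_one]
        exact (Finset.card_le_card (Finset.erase_subset _ _)).trans hS
    have : f = ∑ z, f z • ev (lag z) := by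
      ext z'
      rw [Finset.sum_apply]
      have : ∀ z : Z, (f z • ev (lag z)) z' = if z' = z then f z else 0 := by
        intro z
        change f z * eval z'.1 (lag z) = _
        rw [hlag]; simp
      simp only [this]
      simp
    rw [this]
    apply Submodule.sum_mem
    intro z _
    exact Submodule.smul_mem _ _ (hdeg _ (hlagdeg z))
  have h1 := finrank_range_le_card (R := k) w
  rw [Set.finrank, htop, finrank_top] at h1
  simpa using h1

end CountPts

section CountTensor

attribute [local instance] MvPolynomial.gradedAlgebra

theorem count_tensor (k : Type*) [Field k] [Infinite k] (n κ Δ : ℕ) :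
    ∃ c : ℕ, ∀ a : (Fin (κ+1) → Fin n) → Fin n → k,
      ringKrullDim (MvPolynomial (Fin n) k ⧸
        Ideal.span (Set.range fun j : Fin n => tform (fun s => a s j))) ≤ (Δ : WithBot ℕ∞) →
      ∀ (Z : Finset (Fin (κ+1) × Fin n → k)) (S : Finset k) (t : ℕ), 1 ≤ t → S.card ≤ t →
        (∀ z ∈ Z, ∀ i, z i ∈ S) →
        (∀ z ∈ Z, ∀ j, ∑ s : Fin (κ+1) → Fin n, a s j * ∏ l, z (l, s l) = 0) →
        Z.card ≤ c * t ^ (n * κ + Δ) := by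
  classical
  let D : Fin n ⊕ Fin Δ → ℕ := Sum.elim (fun _ => κ+1) (fun _ => 1)
  obtain ⟨N0, hN0⟩ := uniformN k n D
  refine ⟨N0 ^ ((κ+1) * n) * ((κ+1) * n + 1) ^ (n * κ + Δ), ?_⟩
  intro a hdim Z S t ht hS hZS hZ
  set I0 := Ideal.span (Set.range fun j : Fin n => tform (fun s => a s j)) with hI0
  have hI0h : I0.IsHomogeneous (homogeneousSubmodule (Fin n) k) := by
    apply Ideal.homogeneous_span
    rintro _ ⟨i, rfl⟩
    exact ⟨_, tform_hom _⟩
  have hI0k : I0 ≤ RingHom.ker constantCoeff := by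
    rw [hI0, Ideal.span_le]
    rintro _ ⟨i, rfl⟩
    exact (tform_hom _).coeff_eq_zero (d := 0) (by simp)
  obtain ⟨ℓ, N, hN⟩ := exists_linForms Δ I0 hI0h hI0k hdim
  let A : (Σ i, (Fin (D i) → Fin n)) → k := fun x =>
    match x with
    | ⟨Sum.inl j, s⟩ => a s j
    | ⟨Sum.inr i, s⟩ => ℓ i (s (0 : Fin 1))
  have htf : ∀ i : Fin Δ, tform (fun s : Fin 1 → Fin n => ℓ i (s 0)) = linForm (ℓ i) := by
    intro i
    unfold tform linForm
    rw [← (Equiv.funUnique (Fin 1) (Fin n)).symm.sum_comp]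
    simp
  have hrange : Ideal.span (Set.range fun i => tform (fun s => A ⟨i, s⟩)) =
      I0 ⊔ Ideal.span (Set.range fun i => linForm (ℓ i)) := by
    rw [hI0, ← Ideal.span_union]
    congr 1
    ext p
    simp only [Set.mem_range, Set.mem_union, Sum.exists]
    constructor
    · rintro (⟨j, rfl⟩ | ⟨i, rfl⟩)
      · exact Or.inl ⟨j, rfl⟩
      · exact Or.inr ⟨i, (htf i).symm⟩
    · rintro (⟨j, rfl⟩ | ⟨i, rfl⟩)
      · exact Or.inl ⟨j, rfl⟩
      · exact Or.inr ⟨i, (htf i)⟩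
  have hgood : GoodN D N0 A := by
    apply hN0
    refine ⟨N, fun s => ?_⟩
    rw [hrange]; exact hN s
  let Φ : Fin n → MvPolynomial (Fin (κ+1) × Fin n) k := fun j =>
    ∑ s : Fin (κ+1) → Fin n, C (a s j) * ∏ l, X (l, s l)
  let I := Ideal.span (Set.range Φ)
  have hIh : I.IsHomogeneous (homogeneousSubmodule _ k) := by
    apply Ideal.homogeneous_span
    rintro _ ⟨j, rfl⟩
    refine ⟨κ+1, ?_⟩
    apply IsHomogeneous.sum
    intro s _
    exact (prodX_hom (fun l => (l, s l))).C_mul _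
  let L' : (Fin n × Fin κ) ⊕ Fin Δ → MvPolynomial (Fin (κ+1) × Fin n) k :=
    Sum.elim (fun x => X (x.2.succ, x.1) - X (0, x.1)) (fun i => ∑ m, C (ℓ i m) * X (0, m))
  have hcard : Fintype.card ((Fin n × Fin κ) ⊕ Fin Δ) = n * κ + Δ := by simp
  let eqv := (Fintype.equivFinOfCardEq hcard).symm
  let L : Fin (n * κ + Δ) → MvPolynomial (Fin (κ+1) × Fin n) k := L' ∘ eqv
  have hLr : Set.range L = Set.range L' := eqv.surjective.range_comp L'
  have hLh : ∀ i, (L i).IsHomogeneous 1 := by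
    intro i
    change (L' (eqv i)).IsHomogeneous 1
    rcases eqv i with x | x
    · exact (isHomogeneous_X _ _).sub (isHomogeneous_X _ _)
    · apply IsHomogeneous.sum
      intro m _
      exact (isHomogeneous_X _ _).C_mul _
  set J := I ⊔ Ideal.span (Set.range L) with hJ
  have hΦJ : ∀ j, Ideal.Quotient.mk J (Φ j) = 0 := fun j =>
    Ideal.Quotient.eq_zero_iff_mem.mpr (Ideal.mem_sup_left (Ideal.subset_span ⟨j, rfl⟩))
  have hLJ : ∀ x, Ideal.Quotient.mk J (L' x) = 0 := fun x =>
    Ideal.Quotient.eq_zero_iff_mem.mpr (Ideal.mem_sup_right (Ideal.subset_span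
      (hLr ▸ ⟨x, rfl⟩)))
  have hX : ∀ l i, Ideal.Quotient.mk J (X (l, i)) = Ideal.Quotient.mk J (X (0, i)) := by
    intro l i
    rcases Fin.eq_zero_or_eq_succ l with rfl | ⟨l, rfl⟩
    · rfl
    · have := hLJ (Sum.inl (i, l))
      simp only [L', Sum.elim_inl, map_sub] at this
      exact sub_eq_zero.mp this
  have hmon : ∀ s : Fin N0 → Fin (κ+1) × Fin n, ∏ l, X (s l) ∈ J := by
    intro s
    let φ : MvPolynomial (Fin n) k →+* MvPolynomial (Fin (κ+1) × Fin n) k ⧸ J :=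
      (Ideal.Quotient.mk J).comp (rename (fun i => ((0 : Fin (κ+1)), i))).toRingHom
    have hφX : ∀ i, φ (X i) = Ideal.Quotient.mk J (X (0, i)) := by
      intro i; simp [φ]
    have hφC : ∀ c, φ (C c) = Ideal.Quotient.mk J (C c) := by
      intro i; simp [φ]
    have h0 : Ideal.span (Set.range fun i => tform (fun s => A ⟨i, s⟩)) ≤ RingHom.ker φ := by
      rw [hrange, sup_le_iff, hI0, Ideal.span_le, Ideal.span_le]
      constructor
      · rintro _ ⟨j, rfl⟩
        change φ _ = 0
        rw [← hΦJ j]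
        simp only [tform, Φ, map_sum, map_mul, map_prod, hφX, hφC, hX]
      · rintro _ ⟨i, rfl⟩
        change φ _ = 0
        rw [← hLJ (Sum.inr i)]
        simp only [linForm, L', Sum.elim_inr, map_sum, map_mul, hφX, hφC]
    have h1 : φ _ = 0 := h0 (hgood fun l => (s l).2)
    rw [← Ideal.Quotient.eq_zero_iff_mem, ← h1, map_prod, map_prod]
    apply Finset.prod_congr rfl
    intro l _
    rw [hφX]
    exact hX (s l).1 (s l).2
  have hZ' : ∀ z ∈ Z, ∀ p ∈ I, eval z p = 0 := by
    intro z hz p hp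
    have : I ≤ RingHom.ker (eval z) := by
      rw [Ideal.span_le]
      rintro _ ⟨j, rfl⟩
      change eval z _ = 0
      rw [← hZ z hz j]
      simp [Φ, map_sum, map_mul, map_prod]
    exact this hp
  have hfin := count_pts I hIh L hLh N0 hmon Z hZ' S t hS hZS
  rw [Fintype.card_prod, Fintype.card_fin, Fintype.card_fin] at hfin
  refine hfin.trans ?_
  rw [mul_assoc (N0 ^ ((κ+1) * n)), ← mul_pow]
  gcongr
  nlinarith

end CountTensor

section TensorBlock

/-- all monomials have degree `< m` -/
def DL {A σ : Type*} [CommRing A] (m : ℕ) (p : MvPolynomial σ A) : Prop :=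
  ∀ β : σ →₀ ℕ, m ≤ β.degree → coeff β p = 0

section
variable {A σ : Type*} [CommRing A]

lemma DL.add {m : ℕ} {p q : MvPolynomial σ A} (hp : DL m p) (hq : DL m q) : DL m (p + q) := by
  intro β hβ; rw [coeff_add, hp β hβ, hq β hβ, add_zero]

lemma DL.sum {m : ℕ} {ι : Type*} (s : Finset ι) {p : ι → MvPolynomial σ A}
    (hp : ∀ i ∈ s, DL m (p i)) : DL m (∑ i ∈ s, p i) := by
  intro β hβ; rw [coeff_sum]; exact Finset.sum_eq_zero fun i hi => hp i hi β hβ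

lemma DL.C_mul {m : ℕ} {p : MvPolynomial σ A} (hp : DL m p) (a : A) : DL m (C a * p) := by
  intro β hβ; rw [coeff_C_mul, hp β hβ, mul_zero]

lemma DL.mono {m m' : ℕ} {p : MvPolynomial σ A} (hp : DL m p) (h : m ≤ m') : DL m' p :=
  fun β hβ => hp β (h.trans hβ)

lemma DL.eq_zero {p : MvPolynomial σ A} (hp : DL 0 p) : p = 0 := by
  ext β; simpa using hp β (Nat.zero_le _)

lemma DL.X_mul {m : ℕ} {p : MvPolynomial σ A} (hp : DL m p) (i : σ) : DL (m+1) (X i * p) := by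
  classical
  intro β hβ
  rw [coeff_X_mul']
  split_ifs with h
  · apply hp
    have hle : Finsupp.single i 1 ≤ β := by
      rw [Finsupp.single_le_iff]; exact Nat.one_le_iff_ne_zero.mpr (Finsupp.mem_support_iff.mp h)
    obtain ⟨γ, rfl⟩ := exists_add_of_le hle
    rw [add_tsub_cancel_left]
    rw [map_add, Finsupp.degree_single] at hβ; omega
  · rfl

lemma DL.X_mul' {m : ℕ} {p : MvPolynomial σ A} (hp : DL (m-1) p) (i : σ) : DL m (X i * p) := by
  rcases Nat.eq_zero_or_pos m with rfl | h
  · have : p = 0 := DL.eq_zero hp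
    rw [this, mul_zero]; intro β _; simp
  · have := hp.X_mul i
    rwa [Nat.sub_add_cancel h] at this

lemma DL.pderiv {m : ℕ} {p : MvPolynomial σ A} (hp : DL (m+1) p) (i : σ) :
    DL m (pderiv i p) := by
  classical
  intro β hβ
  rw [coeff_pderiv, hp, zero_mul]
  rw [map_add, Finsupp.degree_single]; omega

end

variable {A : Type*} [CommRing A] {n : ℕ}

/-- shift -/
def shiftP (h : Fin n → A) : MvPolynomial (Fin n) A →ₐ[A] MvPolynomial (Fin n) A :=
  aeval fun i => X i + C (h i)

/-- directional derivative -/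
def dirD (h : Fin n → A) : MvPolynomial (Fin n) A →ₗ[A] MvPolynomial (Fin n) A :=
  ∑ i, h i • (pderiv i).toLinearMap

lemma dirD_apply (h : Fin n → A) (p : MvPolynomial (Fin n) A) :
    dirD h p = ∑ i, C (h i) * pderiv i p := by
  simp [dirD, smul_eq_C_mul]

lemma dirD_X_mul (h : Fin n → A) (p : MvPolynomial (Fin n) A) (i : Fin n) :
    dirD h (X i * p) = C (h i) * p + X i * dirD h p := by
  classical
  simp only [dirD_apply, Derivation.leibniz, smul_eq_mul, pderiv_X, mul_add,
    Finset.sum_add_distrib, Finset.mul_sum]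
  rw [add_comm]
  congr 1
  · rw [Finset.sum_eq_single i]
    · simp
    · intro b _ hb
      simp [Pi.single_apply, hb.symm]
    · simp
  · apply Finset.sum_congr rfl; intro _ _; ring

lemma shift_prod (h : Fin n → A) (m : ℕ) (s : Fin m → Fin n) :
    DL (m+1) (shiftP h (∏ l, X (s l))) ∧
    DL m (shiftP h (∏ l, X (s l)) - ∏ l, X (s l)) ∧
    DL (m-1) (shiftP h (∏ l, X (s l)) - ∏ l, X (s l) - dirD h (∏ l, X (s l))) := by
  induction m with
  | zero =>
    simp only [Finset.univ_eq_empty, Finset.prod_empty, map_one, sub_self]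
    refine ⟨?_, ?_, ?_⟩
    · intro β hβ
      classical
      rw [coeff_one, if_neg]
      rintro rfl
      simp at hβ
    · intro β _; simp
    · intro β _; rw [dirD_apply]; simp
  | succ m ih =>
    obtain ⟨h1, h2, h3⟩ := ih (fun l => s l.succ)
    rw [Fin.prod_univ_succ]
    set p : MvPolynomial (Fin n) A := ∏ l : Fin m, X (s l.succ) with hp
    have hS : shiftP h (X (s 0) * p) = X (s 0) * shiftP h p + C (h (s 0)) * shiftP h p := by
      rw [map_mul]
      simp only [shiftP, aeval_X]; ring
    refine ⟨?_, ?_, ?_⟩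
    · rw [hS]; exact (h1.X_mul _).add ((h1.C_mul _).mono (by omega))
    · rw [hS, show X (s 0) * shiftP h p + C (h (s 0)) * shiftP h p - X (s 0) * p =
        X (s 0) * (shiftP h p - p) + C (h (s 0)) * shiftP h p by ring]
      exact (h2.X_mul _).add (h1.C_mul _)
    · rw [hS, dirD_X_mul, show X (s 0) * shiftP h p + C (h (s 0)) * shiftP h p - X (s 0) * p -
        (C (h (s 0)) * p + X (s 0) * dirD h p) =
        X (s 0) * (shiftP h p - p - dirD h p) + C (h (s 0)) * (shiftP h p - p) by ring]
      exact (h3.X_mul' _).add (h2.C_mul _)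

lemma DL_lin {m m' : ℕ} (E : MvPolynomial (Fin n) A →ₗ[A] MvPolynomial (Fin n) A)
    (hE : ∀ m1 < m, ∀ s : Fin m1 → Fin n, DL m' (E (∏ l, X (s l)))) {p : MvPolynomial (Fin n) A}
    (hp : DL m p) : DL m' (E p) := by
  classical
  rw [p.as_sum, map_sum]
  apply DL.sum
  intro β hβ
  have hlt : β.degree < m := by
    by_contra hcon
    exact mem_support_iff.mp hβ (hp β (not_lt.mp hcon))
  obtain ⟨s, hs⟩ := monomial_eq_prodX (k := A) _ β rfl
  have : monomial β (coeff β p) = coeff β p • ∏ l, X (s l) := by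
    rw [← hs, smul_monomial, smul_eq_mul, mul_one]
  rw [this, map_smul, smul_eq_C_mul]
  exact (hE _ hlt s).C_mul _

lemma shift_sub_DL {m : ℕ} {p : MvPolynomial (Fin n) A} (hp : DL (m+1) p) (h : Fin n → A) :
    DL m (shiftP h p - p) := by
  have := DL_lin (m := m+1) (m' := m) ((shiftP h).toLinearMap - LinearMap.id) ?_ hp
  · simpa using this
  · intro m1 hm1 s
    have := (shift_prod h m1 s).2.1
    exact DL.mono (by simpa using this) (by omega)

lemma shift_sub_sub_DL {m : ℕ} {p : MvPolynomial (Fin n) A} (hp : DL (m+2) p) (h : Fin n → A) :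
    DL m (shiftP h p - p - dirD h p) := by
  have := DL_lin (m := m+2) (m' := m) ((shiftP h).toLinearMap - LinearMap.id - dirD h) ?_ hp
  · simpa using this
  · intro m1 hm1 s
    have := (shift_prod h m1 s).2.2
    exact DL.mono (by simpa using this) (by omega)

/-- iterated derivative, constant coefficient -/
def dten : (k : ℕ) → MvPolynomial (Fin n) A → (Fin k → Fin n) → A
  | 0, p, _ => coeff 0 p
  | k+1, p, s => dten k (pderiv (s 0) p) (Fin.tail s)

/-- derivative tensor -/
def tens (k : ℕ) (p : MvPolynomial (Fin n) A) (s : Fin k → Fin n) (j : Fin n) : A :=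
  dten k (pderiv j p) s

lemma pderiv_swap (i j : Fin n) (p : MvPolynomial (Fin n) A) :
    pderiv i (pderiv j p) = pderiv j (pderiv i p) := by
  classical
  ext β
  simp only [coeff_pderiv]
  by_cases h : i = j
  · subst h; rfl
  · have h' : j ≠ i := fun e => h e.symm
    rw [add_right_comm]
    simp [Finsupp.add_apply, Finsupp.single_apply, h, h']
    ring

lemma tens_succ (k : ℕ) (p : MvPolynomial (Fin n) A) (s : Fin (k+1) → Fin n) (j : Fin n) :
    tens (k+1) p s j = tens k (pderiv (s 0) p) (Fin.tail s) j := by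
  unfold tens
  rw [dten, pderiv_swap]

lemma dten_add (k : ℕ) (p q : MvPolynomial (Fin n) A) (s : Fin k → Fin n) :
    dten k (p + q) s = dten k p s + dten k q s := by
  induction k generalizing p q with
  | zero => simp [dten]
  | succ k ih => simp only [dten, map_add]; exact ih _ _ _

lemma dten_C_mul (k : ℕ) (a : A) (q : MvPolynomial (Fin n) A) (s : Fin k → Fin n) :
    dten k (C a * q) s = a * dten k q s := by
  induction k generalizing q with
  | zero => simp [dten]
  | succ k ih => simp only [dten, pderiv_C_mul, smul_eq_C_mul]; exact ih _ _

lemma dten_zero (k : ℕ) (s : Fin k → Fin n) :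
    dten k (0 : MvPolynomial (Fin n) A) s = 0 := by
  have := dten_C_mul k 0 (0 : MvPolynomial (Fin n) A) s
  simpa using this

lemma tens_add (k : ℕ) (p q : MvPolynomial (Fin n) A) (s : Fin k → Fin n) (j : Fin n) :
    tens k (p + q) s j = tens k p s j + tens k q s j := by
  simp [tens, dten_add]

lemma tens_C_mul (k : ℕ) (a : A) (q : MvPolynomial (Fin n) A) (s : Fin k → Fin n) (j : Fin n) :
    tens k (C a * q) s j = a * tens k q s j := by
  simp only [tens, pderiv_C_mul, smul_eq_C_mul]; exact dten_C_mul _ _ _ _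

lemma tens_zero (k : ℕ) (s : Fin k → Fin n) (j : Fin n) :
    tens k (0 : MvPolynomial (Fin n) A) s j = 0 := by
  simp [tens, dten_zero]

lemma tens_sum (k : ℕ) {ι : Type*} (t : Finset ι) (p : ι → MvPolynomial (Fin n) A)
    (s : Fin k → Fin n) (j : Fin n) :
    tens k (∑ i ∈ t, p i) s j = ∑ i ∈ t, tens k (p i) s j := by
  classical
  induction t using Finset.induction_on with
  | empty => simp [tens_zero]
  | insert a t ha ih => rw [Finset.sum_insert ha, Finset.sum_insert ha, tens_add, ih]

lemma tens_map {B : Type*} [CommRing B] (φ : A →+* B) (k : ℕ) (p : MvPolynomial (Fin n) A)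
    (s : Fin k → Fin n) (j : Fin n) :
    tens k (map φ p) s j = φ (tens k p s j) := by
  unfold tens
  rw [pderiv_map]
  generalize pderiv j p = q
  induction k generalizing q with
  | zero => simp [dten, coeff_map]
  | succ k ih => simp only [dten, pderiv_map]; exact ih _ _

lemma dten_DL {k : ℕ} {p : MvPolynomial (Fin n) A} (hp : DL k p) (s : Fin k → Fin n) :
    dten k p s = 0 := by
  induction k generalizing p with
  | zero => rw [hp.eq_zero, dten_zero]
  | succ k ih => rw [dten]; exact ih (hp.pderiv _) _

lemma tens_DL {k : ℕ} {p : MvPolynomial (Fin n) A} (hp : DL (k+1) p) (s : Fin k → Fin n)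
    (j : Fin n) : tens k p s j = 0 := dten_DL (hp.pderiv j) s

/-- contraction of the first slot -/
def cur {k : ℕ} (T : (Fin (k+1) → Fin n) → Fin n → A) (h : Fin n → A) :
    (Fin k → Fin n) → Fin n → A :=
  fun s j => ∑ a, h a * T (Fin.cons a s) j

lemma tens_cur (k : ℕ) (p : MvPolynomial (Fin n) A) (h : Fin n → A) :
    cur (tens (k+1) p) h = tens k (dirD h p) := by
  funext s j
  rw [dirD_apply, tens_sum]
  unfold cur
  apply Finset.sum_congr rfl
  intro a _
  rw [tens_C_mul, tens_succ]
  simp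

/-- iterated differences of `F` are described by the tensor `T` -/
def IsPh : (k : ℕ) → ((Fin n → ℝ) → ℝ) → ((Fin k → Fin n) → Fin n → ℝ) → Prop
  | 0, F, T => ∃ c : ℝ, ∀ ζ, F ζ = ∑ j, T Fin.elim0 j * ζ j + c
  | k+1, F, T => ∀ h : Fin n → ℝ, IsPh k (fun ζ => F (ζ + h) - F ζ) (cur T h)

lemma eval_shiftP (h ζ : Fin n → A) (p : MvPolynomial (Fin n) A) :
    eval ζ (shiftP h p) = eval (ζ + h) p := by
  induction p using MvPolynomial.induction_on with
  | C a => simp [shiftP]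
  | add p q hp hq => simp [hp, hq]
  | mul_X p i hp => rw [map_mul, map_mul, hp, map_mul]; simp [shiftP]

lemma isPh_tens (k : ℕ) : ∀ (p : MvPolynomial (Fin n) ℝ), DL (k+2) p →
    IsPh k (fun ζ => eval ζ p) (tens k p) := by
  induction k with
  | zero =>
    intro p hp
    refine ⟨coeff 0 p, fun ζ => ?_⟩
    have hs := shift_sub_sub_DL (m := 0) hp ζ
    have h0 := congrArg (eval 0) hs.eq_zero
    rw [map_sub, map_sub, eval_shiftP, zero_add, map_zero, dirD_apply, map_sum] at h0
    have e0 : ∀ q : MvPolynomial (Fin n) ℝ, eval 0 q = coeff 0 q := by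
      intro q
      rw [eval_zero]; rfl
    simp only [e0, coeff_C_mul] at h0
    have : ∑ j, tens 0 p Fin.elim0 j * ζ j = ∑ x, ζ x * coeff 0 (pderiv x p) := by
      apply Finset.sum_congr rfl
      intro j _
      rw [tens, dten, mul_comm]
    rw [this]
    change eval ζ p = _
    linarith
  | succ k ih =>
    intro p hp h
    have h1 := ih _ (shift_sub_DL hp h)
    have h2 : tens k (shiftP h p - p) = cur (tens (k+1) p) h := by
      rw [tens_cur]
      funext s j
      have h3 := tens_DL (shift_sub_sub_DL (m := k+1) hp h) s j
      have h4 := tens_add k (shiftP h p - p - dirD h p) (dirD h p) s j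
      rw [h3, zero_add, sub_add_cancel] at h4
      exact h4
    rw [h2] at h1
    have h5 : (fun ζ => eval (ζ + h) p - eval ζ p) = fun ζ => eval ζ (shiftP h p - p) := by
      funext ζ; rw [map_sub, eval_shiftP]
    rw [h5]; exact h1

lemma tform_dten {k : ℕ} {p : MvPolynomial (Fin n) A} (hp : p.IsHomogeneous k) :
    tform (dten k p) = (k.factorial : ℕ) • p := by
  induction k generalizing p with
  | zero =>
    have : p = C (coeff 0 p) := by
      rw [← totalDegree_eq_zero_iff_eq_C]
      exact Nat.le_zero.mp hp.totalDegree_le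
    simp [tform, dten, ← this]
  | succ k ih =>
    have hE := hp.sum_X_mul_pderiv
    have : tform (dten (k+1) p) = ∑ a, X a * tform (dten k (pderiv a p)) := by
      unfold tform
      rw [← (Fin.consEquiv (fun _ => Fin n)).sum_comp, Fintype.sum_prod_type]
      apply Finset.sum_congr rfl
      intro a _
      rw [Finset.mul_sum]
      apply Finset.sum_congr rfl
      intro s _
      rw [Fin.prod_univ_succ]
      have ht : Fin.tail ((Fin.consEquiv fun _ => Fin n) (a, s)) = s := by
        simp [Fin.consEquiv, Fin.tail_cons]
      simp only [dten, ht]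
      simp only [Fin.consEquiv_apply, Fin.cons_zero, Fin.cons_succ]
      ring
    rw [this]
    have h2 : ∀ a, X a * tform (dten k (pderiv a p)) = (k.factorial : ℕ) • (X a * pderiv a p) := by
      intro a
      rw [ih (by simpa using hp.pderiv (i := a)), mul_smul_comm]
    simp only [h2]
    rw [← Finset.smul_sum, hE, smul_smul, Nat.factorial_succ, mul_comm]

lemma tform_tens {k : ℕ} {p : MvPolynomial (Fin n) A} (hp : p.IsHomogeneous (k+1)) (j : Fin n) :
    tform (fun s => tens k p s j) = (k.factorial : ℕ) • pderiv j p :=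
  tform_dten (by simpa using hp.pderiv (i := j))

lemma coeff_pderiv_bound {m : ℕ} {p : MvPolynomial (Fin n) ℤ} (hp : DL (m+1) p) {B : ℝ}
    (hB0 : 0 ≤ B)
    (hB : ∀ β, |((coeff β p : ℤ) : ℝ)| ≤ B) (i : Fin n) (β) :
    |((coeff β (pderiv i p) : ℤ) : ℝ)| ≤ m * B := by
  rw [coeff_pderiv]
  by_cases h : m + 1 ≤ (β + Finsupp.single i 1).degree
  · rw [hp _ h]; simp; positivity
  · rw [map_add, Finsupp.degree_single] at h
    have h1 := Finsupp.le_degree i β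
    have h2 : ((β i : ℝ) + 1) ≤ m := by
      have : β i + 1 ≤ m := by omega
      exact_mod_cast this
    push_cast
    rw [abs_mul, mul_comm, abs_of_nonneg (by positivity : (0:ℝ) ≤ (β i : ℝ) + 1)]
    exact mul_le_mul h2 (hB _) (abs_nonneg _) (by positivity)

lemma dten_bound {m : ℕ} (k : ℕ) {p : MvPolynomial (Fin n) ℤ} (hp : DL (m+1) p) {B : ℝ}
    (hB0 : 0 ≤ B) (hB : ∀ β, |((coeff β p : ℤ) : ℝ)| ≤ B) (s : Fin k → Fin n) :
    |((dten k p s : ℤ) : ℝ)| ≤ m ^ k * B := by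
  induction k generalizing p B with
  | zero => simpa [dten] using hB 0
  | succ k ih =>
    rw [dten]
    have := ih ((hp.pderiv (s 0)).mono (Nat.le_succ m)) (B := m * B) (by positivity)
      (coeff_pderiv_bound hp hB0 hB (s 0)) (Fin.tail s)
    refine this.trans (le_of_eq ?_)
    ring

lemma tens_bound {m : ℕ} (k : ℕ) {p : MvPolynomial (Fin n) ℤ} (hp : DL (m+1) p) {B : ℝ}
    (hB0 : 0 ≤ B) (hB : ∀ β, |((coeff β p : ℤ) : ℝ)| ≤ B) (s : Fin k → Fin n) (j : Fin n) :
    |((tens k p s j : ℤ) : ℝ)| ≤ m ^ (k+1) * B := by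
  have := dten_bound k ((hp.pderiv j).mono (Nat.le_succ m)) (B := m * B) (by positivity)
      (coeff_pderiv_bound hp hB0 hB j) s
  refine this.trans (le_of_eq ?_)
  ring

end TensorBlock

section LinAlg

lemma linalg_dichotomy {R : ℕ} {ι : Type*} (v : ι → Fin R → ℤ) (B Y : ℝ) (hB : 0 ≤ B) (hY : 0 ≤ Y)
    (hv : ∀ x i, |((v x i : ℤ) : ℝ)| ≤ B) (γ : Fin R → ℝ)
    (hγ : ∀ x, |∑ i, γ i * (v x i : ℝ)| ≤ Y) :
    (∃ b : Fin R → ℤ, b ≠ 0 ∧ ∀ x, ∑ i, b i * v x i = 0) ∨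
    ‖γ‖ ≤ (R.factorial : ℝ) * B ^ (R - 1) * Y := by
  classical
  let vq : ι → Fin R → ℚ := fun x i => (v x i : ℚ)
  by_cases htop : Submodule.span ℚ (Set.range vq) = ⊤
  · right
    obtain ⟨f, hf, -, hli⟩ := Submodule.exists_fun_fin_finrank_span_eq ℚ (Set.range vq)
    have hfr : Module.finrank ℚ (Submodule.span ℚ (Set.range vq)) = R := by
      rw [htop, finrank_top]; simp
    revert f
    rw [hfr]
    intro f hf hli
    choose x hx using hf
    let M : Matrix (Fin R) (Fin R) ℤ := fun a i => v (x a) i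
    have hdetq : (M.map (Int.castRingHom ℚ)).det ≠ 0 := by
      have hrow : (M.map (Int.castRingHom ℚ)).row = f := by
        funext a i
        rw [← hx a]; rfl
      have := (Matrix.linearIndependent_rows_iff_isUnit (A := M.map (Int.castRingHom ℚ))).mp
        (hrow ▸ hli)
      exact (Matrix.isUnit_iff_isUnit_det _).mp this |>.ne_zero
    have hdet : M.det ≠ 0 := by
      intro h0
      apply hdetq
      have := RingHom.map_det (Int.castRingHom ℚ) M
      rw [h0, map_zero] at this
      exact this.symm
    let Mr : Matrix (Fin R) (Fin R) ℝ := M.map (Int.castRingHom ℝ)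
    have hMr : ((M.det : ℤ) : ℝ) = Mr.det := RingHom.map_det (Int.castRingHom ℝ) M
    have h1 : (1 : ℝ) ≤ |Mr.det| := by
      rw [← hMr]
      exact_mod_cast Int.one_le_abs hdet
    let y : Fin R → ℝ := Mr.mulVec γ
    have hy : ∀ a, |y a| ≤ Y := by
      intro a
      have := hγ (x a)
      have he : y a = ∑ i, γ i * (v (x a) i : ℝ) := by
        simp only [y, Matrix.mulVec, dotProduct, Mr, M, Matrix.map_apply]
        apply Finset.sum_congr rfl
        intro i _
        rw [mul_comm]; rfl
      rw [he]; exact this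
    have hcr : Mr.cramer y = Mr.det • γ := by
      rw [Matrix.cramer_eq_adjugate_mulVec]
      simp only [y]
      rw [Matrix.mulVec_mulVec, Matrix.adjugate_mul, Matrix.smul_mulVec, Matrix.one_mulVec]
    rw [pi_norm_le_iff_of_nonneg (by positivity)]
    intro i
    have hci := congrFun hcr i
    rw [Matrix.cramer_apply, Pi.smul_apply, smul_eq_mul] at hci
    have hb : |(Mr.updateCol i y).det| ≤ (R.factorial : ℝ) * B ^ (R - 1) * Y := by
      rw [Matrix.det_apply]
      refine (Finset.abs_sum_le_sum_abs _ _).trans ?_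
      refine (Finset.sum_le_card_nsmul _ _ (B ^ (R-1) * Y) ?_).trans ?_
      · intro σ _
        rw [Units.smul_def, zsmul_eq_mul, abs_mul]
        have : |(((Equiv.Perm.sign σ : ℤˣ) : ℤ) : ℝ)| = 1 := by
          rcases Int.units_eq_one_or (Equiv.Perm.sign σ) with h | h <;> simp [h]
        rw [this, one_mul, Finset.abs_prod, ← Finset.mul_prod_erase _ _ (Finset.mem_univ i), mul_comm]
        apply mul_le_mul _ _ (abs_nonneg _) (by positivity)
        · calc _ ≤ ∏ a ∈ Finset.univ.erase i, B := by
                apply Finset.prod_le_prod (fun _ _ => abs_nonneg _)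
                intro a ha
                rw [Matrix.updateCol_ne (Finset.ne_of_mem_erase ha)]
                exact hv _ _
            _ = _ := by simp
        · rw [Matrix.updateCol_self]; exact hy _
      · simp [Fintype.card_perm, mul_assoc]
    rw [hci, abs_mul] at hb
    rw [Real.norm_eq_abs]
    nlinarith [abs_nonneg (γ i)]
  · left
    obtain ⟨w, hw⟩ : ∃ w, w ∉ Submodule.span ℚ (Set.range vq) := by
      by_contra hcon
      push Not at hcon
      exact htop (eq_top_iff.mpr fun w _ => hcon w)
    obtain ⟨f, hfw, hf⟩ := Submodule.exists_le_ker_of_notMem hw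
    let c : Fin R → ℚ := fun i => f (Pi.single i 1)
    have hfc : ∀ u, f u = ∑ i, u i * c i := by
      intro u
      conv_lhs => rw [← Finset.univ_sum_single u]
      rw [map_sum]
      apply Finset.sum_congr rfl
      intro i _
      have : (Pi.single i (u i) : Fin R → ℚ) = u i • Pi.single i 1 := by
        rw [← Pi.single_smul]; simp
      rw [this, map_smul, smul_eq_mul]
    obtain ⟨D, hD⟩ := IsLocalization.exist_integer_multiples_of_finite (nonZeroDivisors ℤ) c
    choose b hb using hD
    have hD0 : ((D : ℤ) : ℚ) ≠ 0 := by exact_mod_cast nonZeroDivisors.coe_ne_zero D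
    have hb' : ∀ i, (b i : ℚ) = (D : ℤ) * c i := by
      intro i
      have := hb i
      rw [zsmul_eq_mul] at this
      exact this
    refine ⟨b, ?_, ?_⟩
    · rintro rfl
      apply hfw
      rw [hfc]
      apply Finset.sum_eq_zero
      intro i _
      have := hb' i
      simp only [Pi.zero_apply, Int.cast_zero] at this
      rcases mul_eq_zero.mp this.symm with h | h
      · exact absurd h hD0
      · rw [h, mul_zero]
    · intro x
      have h0 : f (vq x) = 0 := hf (Submodule.subset_span ⟨x, rfl⟩)
      rw [hfc] at h0
      have : ((∑ i, b i * v x i : ℤ) : ℚ) = 0 := by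
        push_cast
        calc ∑ i, (b i : ℚ) * (v x i : ℚ) = (D : ℤ) * ∑ i, vq x i * c i := by
              rw [Finset.mul_sum]
              apply Finset.sum_congr rfl
              intro i _
              rw [hb' i]; simp only [vq]; ring
          _ = 0 := by rw [h0, mul_zero]
      exact_mod_cast this

/-- full contraction -/
def evT {A : Type*} [CommRing A] {n k : ℕ} (T : (Fin k → Fin n) → Fin n → A)
    (z : Fin k → Fin n → A) (j : Fin n) : A :=
  ∑ s, T s j * ∏ l, z l (s l)

/-- integer points with small contraction -/
def cntSet {n k : ℕ} (T : (Fin k → Fin n) → Fin n → ℝ) (H : ℕ) : Finset (Fin k → Fin n → ℤ) :=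
  (Fintype.piFinset fun _ => Fintype.piFinset fun _ =>
    Finset.Icc (-(4 * H : ℤ)) (4 * H)).filter
      fun z => ∀ j, |evT T (fun l i => (z l i : ℝ)) j| ≤ (2 * (H : ℝ)) ^ k

lemma DL_of_hom {A σ : Type*} [CommRing A] {m : ℕ} {p : MvPolynomial σ A} (hp : p.IsHomogeneous m) :
    DL (m+1) p := by
  intro β hβ
  exact hp.coeff_eq_zero (by omega)

theorem count_final (F : Type*) [Field F] [CharZero F] (n R κ Δ : ℕ) :
    ∃ c1 c2 : ℝ, 0 < c1 ∧ 0 < c2 ∧ ∀ g : Fin R → MvPolynomial (Fin n) ℤ,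
      (∀ i, (g i).IsHomogeneous (κ+2)) → ∀ Cv : ℝ, 1 ≤ Cv →
      (∀ i β, |((coeff β (g i) : ℤ) : ℝ)| ≤ Cv) →
      (∀ b : Fin R → ℤ, b ≠ 0 → ringKrullDim (MvPolynomial (Fin n) F ⧸
        Ideal.span (Set.range fun j : Fin n => pderiv j
          (map (Int.castRingHom F) (∑ i, b i • g i)))) ≤ (Δ : WithBot ℕ∞)) →
      ∀ (γ : Fin R → ℝ) (H : ℕ), 1 ≤ H → c1 * Cv ^ (R-1) * (H : ℝ) ^ ((κ+1) * R) < ‖γ‖ →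
      ((cntSet (k := κ+1) (fun s j => ∑ i, γ i * ((tens (κ+1) (g i) s j : ℤ) : ℝ)) H).card : ℝ)
        ≤ c2 * (H : ℝ) ^ (n * κ + Δ) := by
  classical
  obtain ⟨c0, hc0⟩ := count_tensor F n κ Δ
  rcases Nat.eq_zero_or_pos R with hR | hR
  · subst hR
    refine ⟨1, 1, one_pos, one_pos, ?_⟩
    intro g _ Cv hCv _ _ γ H hH hlt
    exfalso
    have : γ = 0 := Subsingleton.elim _ _
    rw [this, norm_zero] at hlt
    have : 0 ≤ 1 * Cv ^ (0-1) * (H : ℝ) ^ ((κ+1) * 0) := by positivity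
    linarith
  set E : ℝ := (n : ℝ) ^ (κ+1) * 4 ^ (κ+1) * ((κ+2 : ℕ) : ℝ) ^ (κ+2) + 1 with hE
  have hE0 : 0 < E := by positivity
  refine ⟨R.factorial * E ^ (R-1) * 2 ^ (κ+1), c0 * 9 ^ (n * κ + Δ) + 1, by positivity, by positivity, ?_⟩
  intro g hg Cv hCv hcoef hdim γ H hH hlt
  have hH1 : (1 : ℝ) ≤ H := by exact_mod_cast hH
  set T : (Fin (κ+1) → Fin n) → Fin n → ℝ :=
    fun s j => ∑ i, γ i * ((tens (κ+1) (g i) s j : ℤ) : ℝ) with hT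
  let v : (cntSet T H) × Fin n → Fin R → ℤ := fun x i => evT (tens (κ+1) (g i)) x.1.1 x.2
  have hmem : ∀ z ∈ cntSet T H, (∀ l i, |((z l i : ℤ) : ℝ)| ≤ 4 * H) ∧
      ∀ j, |evT T (fun l i => (z l i : ℝ)) j| ≤ (2 * (H : ℝ)) ^ (κ+1) := by
    intro z hz
    rw [cntSet, Finset.mem_filter, Fintype.mem_piFinset] at hz
    refine ⟨fun l i => ?_, hz.2⟩
    have := Fintype.mem_piFinset.mp (hz.1 l) i
    rw [Finset.mem_Icc] at this
    rw [abs_le]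
    constructor
    · have := this.1
      exact_mod_cast this
    · exact_mod_cast this.2
  have hv : ∀ x i, |((v x i : ℤ) : ℝ)| ≤ E * Cv * (H : ℝ) ^ (κ+1) := by
    intro x i
    simp only [v, evT]
    push_cast
    refine (Finset.abs_sum_le_sum_abs _ _).trans ?_
    refine (Finset.sum_le_card_nsmul _ _ (((κ+2 : ℕ) : ℝ) ^ (κ+2) * Cv * (4 * H) ^ (κ+1)) ?_).trans ?_
    · intro s _
      rw [abs_mul, Finset.abs_prod]
      apply mul_le_mul
      · exact tens_bound (m := κ+2) (κ+1) (DL_of_hom (hg i)) (by linarith) (hcoef i) s x.2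
      · calc _ ≤ ∏ l : Fin (κ+1), (4 * (H : ℝ)) := by
              apply Finset.prod_le_prod (fun _ _ => abs_nonneg _)
              intro l _
              exact (hmem x.1.1 x.1.2).1 l _
          _ = _ := by simp
      · exact Finset.prod_nonneg fun _ _ => abs_nonneg _
      · positivity
    · simp only [Finset.card_univ, Fintype.card_fun, Fintype.card_fin, nsmul_eq_mul]
      rw [hE, mul_pow]
      push_cast
      have : 0 ≤ Cv * (H : ℝ) ^ (κ+1) := by positivity
      nlinarith
  have hγ : ∀ x, |∑ i, γ i * (v x i : ℝ)| ≤ (2 * (H : ℝ)) ^ (κ+1) := by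
    intro x
    have h1 := (hmem x.1.1 x.1.2).2 x.2
    convert h1 using 2
    simp only [v, evT, hT]
    push_cast
    simp only [Finset.mul_sum, Finset.sum_mul]
    rw [Finset.sum_comm]
    apply Finset.sum_congr rfl
    intro s _
    apply Finset.sum_congr rfl
    intro i _
    ring
  rcases linalg_dichotomy v (E * Cv * (H : ℝ) ^ (κ+1)) ((2 * (H : ℝ)) ^ (κ+1)) (by positivity)
    (by positivity) hv γ hγ with ⟨b, hb0, hb⟩ | hle
  · -- counting
    let a : (Fin (κ+1) → Fin n) → Fin n → F := fun s j =>
      tens (κ+1) (map (Int.castRingHom F) (∑ i, b i • g i)) s j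
    have ha : ∀ s j, a s j = ((∑ i, b i * tens (κ+1) (g i) s j : ℤ) : F) := by
      intro s j
      simp only [a]
      rw [tens_map, tens_sum]
      simp only [zsmul_eq_mul]
      have : ∀ i, tens (κ+1) ((b i : MvPolynomial (Fin n) ℤ) * g i) s j = b i * tens (κ+1) (g i) s j := by
        intro i
        have := tens_C_mul (κ+1) (b i) (g i) s j
        rw [← this]
        simp
      simp only [this]
      rfl
    have hhom : (map (Int.castRingHom F) (∑ i, b i • g i)).IsHomogeneous (κ+1+1) := by
      apply IsHomogeneous.map
      apply IsHomogeneous.sum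
      intro i _
      rw [zsmul_eq_mul]
      have := (hg i).C_mul (b i)
      simpa using this
    have hspan : Ideal.span (Set.range fun j : Fin n => tform (fun s => a s j)) =
        Ideal.span (Set.range fun j : Fin n => pderiv j
          (map (Int.castRingHom F) (∑ i, b i • g i))) := by
      have hfac : (((κ+1).factorial : ℕ) : F) ≠ 0 := by
        exact_mod_cast Nat.factorial_ne_zero _
      have he : ∀ j, tform (fun s => a s j) = C (((κ+1).factorial : ℕ) : F) *
          pderiv j (map (Int.castRingHom F) (∑ i, b i • g i)) := by
        intro j
        rw [tform_tens hhom j, nsmul_eq_mul]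
        simp
      apply le_antisymm
      · rw [Ideal.span_le]
        rintro _ ⟨j, rfl⟩
        simp only [he]
        exact Ideal.mul_mem_left _ _ (Ideal.subset_span ⟨j, rfl⟩)
      · rw [Ideal.span_le]
        rintro _ ⟨j, rfl⟩
        have h2 : C ((((κ+1).factorial : ℕ) : F)⁻¹) * tform (fun s => a s j) ∈
            Ideal.span (Set.range fun j : Fin n => tform (fun s => a s j)) :=
          Ideal.mul_mem_left _ _ (Ideal.subset_span ⟨j, rfl⟩)
        rw [he, ← mul_assoc, ← map_mul, inv_mul_cancel₀ hfac, map_one, one_mul] at h2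
        exact h2
    have hd := hdim b hb0
    rw [← hspan] at hd
    let emb : (Fin (κ+1) → Fin n → ℤ) → (Fin (κ+1) × Fin n → F) := fun z x => (z x.1 x.2 : F)
    have hemb : Function.Injective emb := by
      intro z z' h
      funext l i
      have := congrFun h (l, i)
      exact Int.cast_injective this
    have hcard := hc0 a hd ((cntSet T H).image emb)
      ((Finset.Icc (-(4 * H : ℤ)) (4 * H)).image (fun m : ℤ => (m : F))) (9 * H) (by omega) ?_ ?_ ?_
    · rw [Finset.card_image_of_injective _ hemb] at hcard
      have h3 : ((cntSet T H).card : ℝ) ≤ c0 * (9 * (H:ℝ)) ^ (n * κ + Δ) := by exact_mod_cast hcard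
      rw [mul_pow, ← mul_assoc] at h3
      refine h3.trans ?_
      gcongr
      linarith
    · refine Finset.card_image_le.trans ?_
      rw [Int.card_Icc]; omega
    · intro z hz x
      obtain ⟨w, hw, rfl⟩ := Finset.mem_image.mp hz
      apply Finset.mem_image.mpr
      rw [cntSet, Finset.mem_filter, Fintype.mem_piFinset] at hw
      exact ⟨w x.1 x.2, Fintype.mem_piFinset.mp (hw.1 x.1) x.2, rfl⟩
    · intro z hz j
      obtain ⟨w, hw, rfl⟩ := Finset.mem_image.mp hz
      have h4 := hb (⟨w, hw⟩, j)
      have h5 : ((∑ i, b i * v (⟨w, hw⟩, j) i : ℤ) : F) = 0 := by rw [h4]; simp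
      rw [← h5]
      simp only [v, evT, ha, emb]
      push_cast
      simp only [Finset.mul_sum, Finset.sum_mul]
      rw [Finset.sum_comm]
      apply Finset.sum_congr rfl
      intro s _
      apply Finset.sum_congr rfl
      intro i _
      ring
  · exfalso
    refine absurd hlt (not_lt.mpr (hle.trans (le_of_eq ?_)))
    obtain ⟨r, rfl⟩ : ∃ r, R = r + 1 := ⟨R - 1, by omega⟩
    simp only [Nat.add_sub_cancel]
    rw [mul_pow, mul_pow, mul_pow, ← pow_mul]
    ring

end LinAlg

section Blich
open scoped ENNReal Pointwise

/-- integer vector as a real vector -/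
def icast {n : ℕ} (m : Fin n → ℤ) : Fin n → ℝ := fun i => (m i : ℝ)

lemma lintegral_unfold {n : ℕ} (f : (Fin n → ℝ) → ℝ≥0∞) :
    ∫⁻ x, f x = ∑' m : Fin n → ℤ, ∫⁻ x in {x | ∀ i, ⌊x i⌋ = 0}, f (x + icast m) := by
  have hmeas : ∀ m : Fin n → ℤ, MeasurableSet {x : Fin n → ℝ | ∀ i, ⌊x i⌋ = m i} := by
    intro m
    have : {x : Fin n → ℝ | ∀ i, ⌊x i⌋ = m i} = ⋂ i, (fun x : Fin n → ℝ => ⌊x i⌋) ⁻¹' {m i} := by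
      ext x; simp
    rw [this]
    refine MeasurableSet.iInter fun i => ?_
    exact (Int.measurable_floor.comp (measurable_pi_apply i)) (measurableSet_singleton _)
  have huniv : (⋃ m : Fin n → ℤ, {x : Fin n → ℝ | ∀ i, ⌊x i⌋ = m i}) = Set.univ := by
    ext x
    simp only [Set.mem_iUnion, Set.mem_setOf_eq, Set.mem_univ, iff_true]
    exact ⟨fun i => ⌊x i⌋, fun i => rfl⟩
  rw [← setLIntegral_univ, ← huniv, lintegral_iUnion hmeas]
  · congr 1
    funext m
    rw [← lintegral_indicator (hmeas m), ← lintegral_indicator (by simpa using hmeas 0),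
      ← lintegral_add_right_eq_self _ (icast m)]
    congr 1
    funext x
    have : (x + icast m ∈ {x : Fin n → ℝ | ∀ i, ⌊x i⌋ = m i}) ↔ x ∈ {x : Fin n → ℝ | ∀ i, ⌊x i⌋ = 0} := by
      simp [icast]
    simp only [Set.indicator, this]
  · intro m m' hne
    rw [Function.onFun, Set.disjoint_left]
    intro x hx hx'
    exact hne (funext fun i => (hx i).symm.trans (hx' i))

lemma vol_cube0 (n : ℕ) : volume {x : Fin n → ℝ | ∀ i, ⌊x i⌋ = 0} = 1 := by
  have : {x : Fin n → ℝ | ∀ i, ⌊x i⌋ = 0} = Set.univ.pi fun _ => Set.Ico (0:ℝ) 1 := by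
    ext x
    simp [Int.floor_eq_zero_iff]
  rw [this, Real.volume_pi_Ico]
  simp

lemma blichfeldt {n : ℕ} (A : Set (Fin n → ℝ)) (hA : MeasurableSet A) (D : Finset (Fin n → ℤ))
    (hD : ∀ x ∈ A, ∀ y ∈ A, ∀ m : Fin n → ℤ, x - y = icast m → m ∈ D) :
    volume A ≤ D.card := by
  classical
  rw [← lintegral_indicator_one hA, lintegral_unfold, ← lintegral_tsum]
  · calc _ ≤ ∫⁻ x in {x : Fin n → ℝ | ∀ i, ⌊x i⌋ = 0}, (D.card : ℝ≥0∞) := by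
          apply lintegral_mono
          intro x
          by_cases hx : ∃ m0, x + icast m0 ∈ A
          · obtain ⟨m0, hm0⟩ := hx
            have hsub : ∀ m, m ∉ D.image (fun d => d + m0) →
                A.indicator (1 : (Fin n → ℝ) → ℝ≥0∞) (x + icast m) = 0 := by
              intro m hm
              rw [Set.indicator_of_notMem]
              intro hmem
              apply hm
              rw [Finset.mem_image]
              refine ⟨m - m0, hD _ hmem _ hm0 _ ?_, by simp⟩
              funext i; simp [icast]
            dsimp only
            rw [tsum_eq_sum hsub]
            refine (Finset.sum_le_card_nsmul _ _ 1 ?_).trans ?_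
            · intro m _
              exact Set.indicator_le_self' (by simp) _
            · rw [nsmul_eq_mul, mul_one]
              exact_mod_cast Finset.card_image_le
          · push Not at hx
            have : ∀ m, A.indicator (1 : (Fin n → ℝ) → ℝ≥0∞) (x + icast m) = 0 := fun m =>
              Set.indicator_of_notMem (hx m) _
            simp [this]
      _ = _ := by rw [setLIntegral_const, vol_cube0, mul_one]
  · intro m
    exact ((measurable_one.indicator hA).comp (measurable_add_const _)).aemeasurable

/-- iterated volume -/
def VV {n : ℕ} : (k : ℕ) → ((Fin k → Fin n) → Fin n → ℝ) → ℝ≥0∞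
  | 0, T => open Classical in if ∀ j, |T Fin.elim0 j| ≤ 1 then 1 else 0
  | k+1, T => ∫⁻ h in Set.Icc (fun _ : Fin n => (-2:ℝ)) (fun _ => 2), VV k (cur T h)

lemma evT_cons {A : Type*} [CommRing A] {n k : ℕ} (T : (Fin (k+1) → Fin n) → Fin n → A)
    (h : Fin n → A) (z : Fin k → Fin n → A) (j : Fin n) :
    evT T (Fin.cons h z) j = evT (cur T h) z j := by
  unfold evT cur
  rw [← (Fin.consEquiv (fun _ => Fin n)).sum_comp, Fintype.sum_prod_type]
  simp only [Finset.sum_mul]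
  rw [Finset.sum_comm]
  apply Finset.sum_congr rfl
  intro s _
  apply Finset.sum_congr rfl
  intro a _
  rw [Fin.prod_univ_succ]
  have hc : (Fin.consEquiv fun _ => Fin n) (a, s) = Fin.cons a s := rfl
  rw [hc]
  simp only [Fin.cons_zero, Fin.cons_succ]
  ring

lemma evT_cur_lin {n k : ℕ} (T : (Fin (k+1) → Fin n) → Fin n → ℝ) (z : Fin k → Fin n → ℝ) :
    ∃ L : (Fin n → ℝ) →ₗ[ℝ] (Fin n → ℝ), ∀ h j, evT (cur T h) z j = L h j := by
  refine ⟨⟨⟨fun h j => evT (cur T h) z j, ?_⟩, ?_⟩, fun h j => rfl⟩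
  · intro h h'
    funext j
    simp only [evT, cur, Pi.add_apply, add_mul, Finset.sum_add_distrib]
  · intro a h
    funext j
    simp only [evT, cur, Pi.smul_apply, smul_eq_mul, RingHom.id_apply, Finset.mul_sum,
      Finset.sum_mul]
    apply Finset.sum_congr rfl
    intro s _
    apply Finset.sum_congr rfl
    intro i _
    ring

lemma vol_lin_le {n : ℕ} (L : (Fin n → ℝ) →ₗ[ℝ] (Fin n → ℝ)) (H : ℕ) (hH : 1 ≤ H) (Y : ℝ) :
    volume {h : Fin n → ℝ | h ∈ Set.Icc (fun _ : Fin n => (-2:ℝ)) (fun _ => 2) ∧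
      ∀ j, |L h j| ≤ Y} ≤ ENNReal.ofReal (((H : ℝ) ^ n)⁻¹) *
      (((Fintype.piFinset fun _ : Fin n => Finset.Icc (-(4 * H : ℤ)) (4 * H)).filter
        fun m => ∀ j, |L (icast m) j| ≤ 2 * H * Y).card : ℝ≥0∞) := by
  classical
  have hH1 : (1 : ℝ) ≤ H := by exact_mod_cast hH
  have hH0 : (0 : ℝ) < H := by linarith
  set A : Set (Fin n → ℝ) := {h | h ∈ Set.Icc (fun _ : Fin n => (-2:ℝ)) (fun _ => 2) ∧
      ∀ j, |L h j| ≤ Y} with hA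
  have hAm : MeasurableSet A := by
    have hLc : Continuous L := LinearMap.continuous_of_finiteDimensional L
    have : A = Set.Icc (fun _ : Fin n => (-2:ℝ)) (fun _ => 2) ∩ ⋂ j, {h | |L h j| ≤ Y} := by
      ext h; simp [hA]
    rw [this]
    apply measurableSet_Icc.inter
    refine MeasurableSet.iInter fun j => ?_
    have hc : Continuous fun h => |L h j| := ((continuous_apply j).comp hLc).abs
    exact (isClosed_le hc continuous_const).measurableSet
  have hscale : volume ((H : ℝ) • A) = ENNReal.ofReal ((H : ℝ) ^ n) * volume A := by
    rw [Measure.addHaar_smul]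
    simp
  have hHA : MeasurableSet ((H : ℝ) • A) := hAm.const_smul₀ _
  have hb := blichfeldt ((H : ℝ) • A) hHA
    ((Fintype.piFinset fun _ : Fin n => Finset.Icc (-(4 * H : ℤ)) (4 * H)).filter
        fun m => ∀ j, |L (icast m) j| ≤ 2 * H * Y) ?_
  · rw [hscale] at hb
    calc volume A = ENNReal.ofReal (((H : ℝ) ^ n)⁻¹) * (ENNReal.ofReal ((H : ℝ) ^ n) * volume A) := by
          rw [← mul_assoc, ← ENNReal.ofReal_mul (by positivity), inv_mul_cancel₀ (by positivity)]
          simp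
      _ ≤ _ := by gcongr
  · rintro x ⟨u, hu, rfl⟩ y ⟨w, hw, rfl⟩ m hm
    have hm' : ∀ i, (m i : ℝ) = H * u i - H * w i := by
      intro i
      have := congrFun hm i
      simpa [icast] using this.symm
    rw [Finset.mem_filter, Fintype.mem_piFinset]
    constructor
    · intro i
      have hu1 := hu.1.1 i
      have hu2 := hu.1.2 i
      have hw1 := hw.1.1 i
      have hw2 := hw.1.2 i
      dsimp only at hu1 hu2 hw1 hw2
      rw [Finset.mem_Icc]
      constructor
      · have : (-(4 * H) : ℝ) ≤ m i := by rw [hm']; nlinarith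
        exact_mod_cast this
      · have : (m i : ℝ) ≤ 4 * H := by rw [hm']; nlinarith
        exact_mod_cast this
    · intro j
      rw [← hm, map_sub]
      simp only [map_smul, Pi.sub_apply, Pi.smul_apply, smul_eq_mul]
      have h1 := hu.2 j
      have h2 := hw.2 j
      rw [← mul_sub, abs_mul, abs_of_pos hH0]
      have := abs_sub (L u j) (L w j)
      nlinarith

lemma cntSet_succ_le {n k : ℕ} (T : (Fin (k+1) → Fin n) → Fin n → ℝ) (H : ℕ) :
    ∑ z ∈ (Fintype.piFinset fun _ : Fin k => Fintype.piFinset fun _ : Fin n =>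
      Finset.Icc (-(4 * H : ℤ)) (4 * H)),
      ((Fintype.piFinset fun _ : Fin n => Finset.Icc (-(4 * H : ℤ)) (4 * H)).filter
        fun m => ∀ j, |evT (cur T (icast m)) (fun l => icast (z l)) j| ≤ 2 * H * (2 * H) ^ k).card
      ≤ (cntSet T H).card := by
  classical
  rw [← Finset.card_sigma]
  refine Finset.card_le_card_of_injOn (fun x => (Fin.cons x.2 x.1 : Fin (k+1) → Fin n → ℤ)) ?_ ?_
  · rintro ⟨z, m⟩ hx
    rw [Finset.mem_coe, Finset.mem_sigma, Finset.mem_filter] at hx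
    obtain ⟨hz, hm, hle⟩ := hx
    rw [Finset.mem_coe, cntSet, Finset.mem_filter]
    constructor
    · rw [Fintype.mem_piFinset]
      intro l
      refine Fin.cases ?_ (fun l => ?_) l
      · exact hm
      · exact Fintype.mem_piFinset.mp hz l
    · intro j
      have := hle j
      rw [← evT_cons] at this
      rw [pow_succ']
      convert this using 3
      funext l
      refine Fin.cases ?_ (fun l => ?_) l
      · rfl
      · rfl
  · rintro ⟨z, m⟩ _ ⟨z', m'⟩ _ h
    obtain ⟨h1, h2⟩ := Fin.cons_injective2 h
    dsimp only at h1 h2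
    rw [h1, h2]

theorem VV_le_count {n : ℕ} (H : ℕ) (hH : 1 ≤ H) (k : ℕ) : ∀ T : (Fin k → Fin n) → Fin n → ℝ,
    VV k T ≤ ENNReal.ofReal (((H : ℝ) ^ (n * k))⁻¹) * ((cntSet T H).card : ℝ≥0∞) := by
  classical
  induction k with
  | zero =>
    intro T
    rw [VV]
    split_ifs with h
    · have : Fin.elim0 ∈ cntSet T H := by
        rw [cntSet, Finset.mem_filter]
        refine ⟨Fintype.mem_piFinset.mpr fun l => l.elim0, fun j => ?_⟩
        have : evT T (fun l i => ((Fin.elim0 l : Fin n → ℤ) i : ℝ)) j = T Fin.elim0 j := by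
          unfold evT
          rw [Fintype.sum_subsingleton _ (Fin.elim0 : Fin 0 → Fin n)]
          simp
        rw [this, pow_zero]; exact h j
      have : 1 ≤ (cntSet T H).card := Finset.card_pos.mpr ⟨_, this⟩
      simp only [mul_zero, pow_zero, inv_one, ENNReal.ofReal_one, one_mul]
      exact_mod_cast this
    · exact zero_le
  | succ k ih =>
    intro T
    rw [VV]
    have hH1 : (1 : ℝ) ≤ H := by exact_mod_cast hH
    set box := (Fintype.piFinset fun _ : Fin k => Fintype.piFinset fun _ : Fin n =>
      Finset.Icc (-(4 * H : ℤ)) (4 * H)) with hbox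
    set Q := Set.Icc (fun _ : Fin n => (-2:ℝ)) (fun _ => 2) with hQ
    let Az : (Fin k → Fin n → ℤ) → Set (Fin n → ℝ) := fun z =>
      {h | ∀ j, |evT (cur T h) (fun l => icast (z l)) j| ≤ (2 * (H : ℝ)) ^ k}
    have hAz : ∀ z, MeasurableSet (Az z) := by
      intro z
      obtain ⟨L, hL⟩ := evT_cur_lin T (fun l => icast (z l))
      have hLc : Continuous L := LinearMap.continuous_of_finiteDimensional L
      have : Az z = ⋂ j, {h | |L h j| ≤ (2 * (H : ℝ)) ^ k} := by
        ext h; simp [Az, hL]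
      rw [this]
      refine MeasurableSet.iInter fun j => ?_
      have hc : Continuous fun h => |L h j| := ((continuous_apply j).comp hLc).abs
      exact (isClosed_le hc continuous_const).measurableSet
    have hcard : ∀ h, ((cntSet (cur T h) H).card : ℝ≥0∞) =
        ∑ z ∈ box, (Az z).indicator 1 h := by
      intro h
      rw [cntSet, Finset.card_filter]
      push_cast
      apply Finset.sum_congr rfl
      intro z _
      simp only [Set.indicator, Az, Set.mem_ofPred_eq, Pi.one_apply]
      rfl
    calc ∫⁻ h in Q, VV k (cur T h)
        ≤ ∫⁻ h in Q, ENNReal.ofReal (((H : ℝ) ^ (n * k))⁻¹) * ∑ z ∈ box, (Az z).indicator 1 h := by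
          apply lintegral_mono
          intro h
          dsimp only
          rw [← hcard]
          exact ih _
      _ = ENNReal.ofReal (((H : ℝ) ^ (n * k))⁻¹) * ∑ z ∈ box, volume (Q ∩ Az z) := by
          rw [lintegral_const_mul, lintegral_finsetSum]
          · congr 1
            apply Finset.sum_congr rfl
            intro z _
            rw [lintegral_indicator_one (hAz z), Measure.restrict_apply (hAz z), Set.inter_comm]
          · intro z _
            exact measurable_one.indicator (hAz z)
          · exact Finset.measurable_fun_sum _ fun z _ => measurable_one.indicator (hAz z)
      _ ≤ ENNReal.ofReal (((H : ℝ) ^ (n * k))⁻¹) * ∑ z ∈ box, (ENNReal.ofReal (((H : ℝ) ^ n)⁻¹) *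
          (((Fintype.piFinset fun _ : Fin n => Finset.Icc (-(4 * H : ℤ)) (4 * H)).filter
        fun m => ∀ j, |evT (cur T (icast m)) (fun l => icast (z l)) j| ≤ 2 * H * (2 * H) ^ k).card : ℝ≥0∞)) := by
          gcongr with z hz
          obtain ⟨L, hL⟩ := evT_cur_lin T (fun l => icast (z l))
          have := vol_lin_le L H hH ((2 * (H : ℝ)) ^ k)
          simp only [← hL] at this
          exact this
      _ ≤ ENNReal.ofReal (((H : ℝ) ^ (n * k))⁻¹) * (ENNReal.ofReal (((H : ℝ) ^ n)⁻¹) *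
          ((cntSet T H).card : ℝ≥0∞)) := by
          rw [← Finset.mul_sum]
          gcongr
          exact_mod_cast cntSet_succ_le T H
      _ = _ := by
          rw [← mul_assoc, ← ENNReal.ofReal_mul (by positivity), ← mul_inv, ← pow_add, Nat.mul_succ]

end Blich

section LogBlock
open scoped ENNReal

/-- harmonic type sum -/
def Ssum (X : ℕ) : ℝ := ∑ m ∈ Finset.Icc (-(X:ℤ)) X, 3 / (1 + |(m:ℝ)|)

lemma Ssum_nonneg (X : ℕ) : 0 ≤ Ssum X := Finset.sum_nonneg fun _ _ => by positivity

lemma Ssum_le (ε : ℝ) (hε : 0 < ε) : ∃ c : ℝ, 0 < c ∧ ∀ X : ℕ, 1 ≤ X → Ssum X ≤ c * (X:ℝ) ^ ε := by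
  have hs : Summable fun m : ℤ => (1 + |(m:ℝ)|) ^ (-(1+ε)) := by
    have h1 : Summable fun m : ℕ => (1 + (m:ℝ)) ^ (-(1+ε)) := by
      have := (summable_nat_add_iff (f := fun m : ℕ => (m:ℝ) ^ (-(1+ε))) 1).mpr
        (Real.summable_nat_rpow.mpr (by linarith))
      refine this.congr fun m => ?_
      push_cast; rw [add_comm]
    apply Summable.of_nat_of_neg
    · simpa using h1
    · simpa using h1
  set ζ := ∑' m : ℤ, (1 + |(m:ℝ)|) ^ (-(1+ε)) with hζ
  have hζ0 : 0 ≤ ζ := tsum_nonneg fun m => by positivity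
  refine ⟨3 * 2 ^ ε * ζ + 1, by positivity, fun X hX => ?_⟩
  have hX1 : (1:ℝ) ≤ X := by exact_mod_cast hX
  have h1 : Ssum X ≤ ∑ m ∈ Finset.Icc (-(X:ℤ)) X, 3 * (2 * X) ^ ε * (1 + |(m:ℝ)|) ^ (-(1+ε)) := by
    apply Finset.sum_le_sum
    intro m hm
    have hm' : |(m:ℝ)| ≤ X := by
      rw [Finset.mem_Icc] at hm
      rw [abs_le]
      exact ⟨by exact_mod_cast hm.1, by exact_mod_cast hm.2⟩
    have hp : (0:ℝ) < 1 + |(m:ℝ)| := by positivity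
    rw [Real.rpow_neg hp.le, Real.rpow_add hp, Real.rpow_one, mul_inv, ← div_eq_mul_inv, div_eq_mul_inv,
      mul_assoc]
    have h2 : (1 + |(m:ℝ)|) ^ ε ≤ (2 * X) ^ ε := Real.rpow_le_rpow hp.le (by linarith) hε.le
    have h3 : 1 ≤ (2 * (X:ℝ)) ^ ε * ((1 + |(m:ℝ)|) ^ ε)⁻¹ := by
      rw [← div_eq_mul_inv, one_le_div (by positivity)]; exact h2
    have h4 : 0 < (1 + |(m:ℝ)|)⁻¹ := by positivity
    calc 3 * (1 + |(m:ℝ)|)⁻¹ = 3 * ((1 + |(m:ℝ)|)⁻¹ * 1) := by ring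
      _ ≤ 3 * ((1 + |(m:ℝ)|)⁻¹ * ((2 * (X:ℝ)) ^ ε * ((1 + |(m:ℝ)|) ^ ε)⁻¹)) := by gcongr
      _ = _ := by ring
  rw [← Finset.mul_sum] at h1
  have h5 : ∑ m ∈ Finset.Icc (-(X:ℤ)) X, (1 + |(m:ℝ)|) ^ (-(1+ε)) ≤ ζ :=
    hs.sum_le_tsum _ fun m _ => by positivity
  calc Ssum X ≤ _ := h1
    _ ≤ 3 * (2 * X) ^ ε * ζ := by gcongr
    _ = 3 * 2 ^ ε * ζ * X ^ ε := by rw [Real.mul_rpow (by norm_num) (by positivity)]; ring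
    _ ≤ _ := by
      have : 0 ≤ (X:ℝ) ^ ε := by positivity
      nlinarith

lemma log_one {n : ℕ} (L : (Fin n → ℝ) →ₗ[ℝ] (Fin n → ℝ)) (X : ℕ) (hX : 1 ≤ X) :
    ∫⁻ h in Set.Icc (fun _ : Fin n => (-1:ℝ)) (fun _ => 1),
      ENNReal.ofReal (∏ j, (max 1 |L h j|)⁻¹) ≤
    ENNReal.ofReal (2 ^ n / X) + ENNReal.ofReal (Ssum X ^ n) *
      volume {h : Fin n → ℝ | h ∈ Set.Icc (fun _ : Fin n => (-2:ℝ)) (fun _ => 2) ∧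
      ∀ j, |L h j| ≤ 1} := by
  classical
  have hX1 : (1:ℝ) ≤ X := by exact_mod_cast hX
  have hLc : Continuous L := LinearMap.continuous_of_finiteDimensional L
  set E := {h : Fin n → ℝ | h ∈ Set.Icc (fun _ : Fin n => (-2:ℝ)) (fun _ => 2) ∧
      ∀ j, |L h j| ≤ 1} with hE
  set Q := Set.Icc (fun _ : Fin n => (-1:ℝ)) (fun _ => 1) with hQ
  let A : (Fin n → ℤ) → Set (Fin n → ℝ) := fun m => {h | ∀ j, ⌊L h j⌋ = m j}
  have hA : ∀ m, MeasurableSet (A m) := by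
    intro m
    have : A m = ⋂ j, (fun h : Fin n → ℝ => ⌊L h j⌋) ⁻¹' {m j} := by
      ext x; simp [A]
    rw [this]
    refine MeasurableSet.iInter fun j => ?_
    have hc : Continuous fun h => L h j := (continuous_apply j).comp hLc
    exact (Int.measurable_floor.comp hc.measurable) (measurableSet_singleton _)
  have hvol : ∀ m, volume (Q ∩ A m) ≤ volume E := by
    intro m
    rcases Set.eq_empty_or_nonempty (Q ∩ A m) with h | ⟨h0, hh0⟩
    · rw [h]; simp
    · have hsub : (fun x => x + h0) ⁻¹' (Q ∩ A m) ⊆ E := by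
        intro x hx
        obtain ⟨hxQ, hxA⟩ := hx
        have a1 := hxQ.1
        have a2 := hxQ.2
        have b1 := hh0.1.1
        have b2 := hh0.1.2
        refine ⟨⟨fun i => ?_, fun i => ?_⟩, fun j => ?_⟩
        · have := a1 i; have := b2 i
          simp only [Pi.add_apply] at *; linarith
        · have := a2 i; have := b1 i
          simp only [Pi.add_apply] at *; linarith
        · have c1 := hxA j
          have c2 := hh0.2 j
          rw [← c2, map_add, Pi.add_apply] at c1
          have c3 := Int.abs_sub_lt_one_of_floor_eq_floor c1
          rw [add_sub_cancel_right] at c3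
          exact c3.le
      calc volume (Q ∩ A m) = volume ((fun x => x + h0) ⁻¹' (Q ∩ A m)) :=
            (measure_preimage_add_right _ _ _).symm
        _ ≤ _ := measure_mono hsub
  set t := Fintype.piFinset fun _ : Fin n => Finset.Icc (-(X:ℤ)) X with ht
  let w : (Fin n → ℤ) → ℝ := fun m => ∏ j, 3 / (1 + |(m j:ℝ)|)
  have hw0 : ∀ m, 0 ≤ w m := fun m => Finset.prod_nonneg fun _ _ => by positivity
  have hpt : ∀ h, ENNReal.ofReal (∏ j, (max 1 |L h j|)⁻¹) ≤
      ENNReal.ofReal (1 / X) + ∑ m ∈ t, ENNReal.ofReal (w m) * (A m).indicator 1 h := by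
    intro h
    by_cases hbig : ∃ j, (X:ℝ) < |L h j|
    · obtain ⟨j, hj⟩ := hbig
      refine le_trans ?_ le_self_add
      apply ENNReal.ofReal_le_ofReal
      rw [← Finset.mul_prod_erase _ _ (Finset.mem_univ j), one_div]
      calc (max 1 |L h j|)⁻¹ * ∏ i ∈ Finset.univ.erase j, (max 1 |L h i|)⁻¹
          ≤ (X:ℝ)⁻¹ * 1 := by
            apply mul_le_mul
            · exact inv_anti₀ (by linarith) (hj.le.trans (le_max_right _ _))
            · apply Finset.prod_le_one
              · intro i _; positivity
              · intro i _; exact inv_le_one_of_one_le₀ (le_max_left _ _)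
            · exact Finset.prod_nonneg fun _ _ => by positivity
            · positivity
        _ = _ := mul_one _
    · push Not at hbig
      refine le_trans ?_ le_add_self
      let m : Fin n → ℤ := fun j => ⌊L h j⌋
      have hm : m ∈ t := by
        rw [ht, Fintype.mem_piFinset]
        intro j
        have := abs_le.mp (hbig j)
        rw [Finset.mem_Icc]
        constructor
        · apply Int.le_floor.mpr; push_cast; exact this.1
        · have h1 := (Int.floor_le (L h j)).trans this.2
          exact_mod_cast h1
      refine le_trans ?_ (Finset.single_le_sum (f := fun m => ENNReal.ofReal (w m) * (A m).indicator 1 h)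
        (fun _ _ => zero_le) hm)
      have hmem : h ∈ A m := fun j => rfl
      rw [Set.indicator_of_mem hmem, Pi.one_apply, mul_one]
      apply ENNReal.ofReal_le_ofReal
      apply Finset.prod_le_prod
      · intro i _; positivity
      · intro j _
        have h1 := Int.floor_le (L h j)
        have h2 := Int.lt_floor_add_one (L h j)
        change _ ≤ 3 / (1 + |((⌊L h j⌋ : ℤ) : ℝ)|)
        set q : ℝ := ((⌊L h j⌋ : ℤ) : ℝ)
        rw [← one_div, div_le_div_iff₀ (by positivity) (by positivity)]
        have h3 : |q| ≤ |L h j| + 1 := by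
          have : |q - L h j| ≤ 1 := by rw [abs_le]; constructor <;> linarith
          have := abs_sub_abs_le_abs_sub q (L h j)
          linarith
        have h4 := le_max_left 1 |L h j|
        have h5 := le_max_right 1 |L h j|
        linarith
  calc _ ≤ ∫⁻ h in Q, (ENNReal.ofReal (1 / X) +
          ∑ m ∈ t, ENNReal.ofReal (w m) * (A m).indicator 1 h) := lintegral_mono hpt
    _ = ENNReal.ofReal (1 / X) * volume Q +
          ∑ m ∈ t, ENNReal.ofReal (w m) * volume (Q ∩ A m) := by
        rw [lintegral_add_left measurable_const, setLIntegral_const, lintegral_finsetSum]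
        · congr 1
          apply Finset.sum_congr rfl
          intro m _
          rw [lintegral_const_mul _ (measurable_one.indicator (hA m)),
            lintegral_indicator_one (hA m), Measure.restrict_apply (hA m), Set.inter_comm]
        · intro m _
          exact (measurable_one.indicator (hA m)).const_mul _
    _ ≤ ENNReal.ofReal (1 / X) * volume Q +
          ∑ m ∈ t, ENNReal.ofReal (w m) * volume E := by
        exact add_le_add le_rfl (Finset.sum_le_sum fun m _ => mul_le_mul' le_rfl (hvol m))
    _ = _ := by
        congr 1
        · rw [hQ, Real.volume_Icc_pi]
          simp only [sub_neg_eq_add, Finset.prod_const, Finset.card_univ, Fintype.card_fin]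
          rw [← ENNReal.ofReal_pow (by norm_num), ← ENNReal.ofReal_mul (by positivity)]
          congr 1
          norm_num
          ring
        · rw [← Finset.sum_mul, ← ENNReal.ofReal_sum_of_nonneg fun m _ => hw0 m]
          congr 2
          have := Finset.prod_univ_sum (fun _ : Fin n => Finset.Icc (-(X:ℤ)) X)
            (fun _ m => 3 / (1 + |(m:ℝ)|))
          rw [← this]
          simp [Ssum]

/-- iterated decay integral -/
def EE {n : ℕ} : (k : ℕ) → ((Fin k → Fin n) → Fin n → ℝ) → ℝ≥0∞
  | 0, T => ENNReal.ofReal (∏ j, (max 1 |T Fin.elim0 j|)⁻¹)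
  | k+1, T => ∫⁻ h in Set.Icc (fun _ : Fin n => (-1:ℝ)) (fun _ => 1), EE k (cur T h)

theorem EE_le {n : ℕ} (X : ℕ) (hX : 1 ≤ X) (k : ℕ) : ∀ T : (Fin (k+1) → Fin n) → Fin n → ℝ,
    EE (k+1) T ≤ ENNReal.ofReal (2 ^ (n * (k+1)) / X) + ENNReal.ofReal (Ssum X ^ n) * VV (k+1) T := by
  classical
  have hX1 : (1:ℝ) ≤ X := by exact_mod_cast hX
  induction k with
  | zero =>
    intro T
    let L : (Fin n → ℝ) →ₗ[ℝ] (Fin n → ℝ) :=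
      { toFun := fun h => cur T h Fin.elim0
        map_add' := by
          intro h h'; funext j; simp [cur, add_mul, Finset.sum_add_distrib]
        map_smul' := by
          intro a h; funext j; simp [cur, Finset.mul_sum, mul_assoc] }
    have h1 := log_one L X hX
    have hLc : Continuous L := LinearMap.continuous_of_finiteDimensional L
    have hEm : MeasurableSet {h : Fin n → ℝ | ∀ j, |L h j| ≤ 1} := by
      have : {h : Fin n → ℝ | ∀ j, |L h j| ≤ 1} = ⋂ j, {h | |L h j| ≤ 1} := by
        ext h; simp
      rw [this]
      refine MeasurableSet.iInter fun j => ?_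
      have hc : Continuous fun h => |L h j| := ((continuous_apply j).comp hLc).abs
      exact (isClosed_le hc continuous_const).measurableSet
    have h2 : VV 1 T = volume {h : Fin n → ℝ | h ∈ Set.Icc (fun _ : Fin n => (-2:ℝ)) (fun _ => 2) ∧
      ∀ j, |L h j| ≤ 1} := by
      have : {h : Fin n → ℝ | h ∈ Set.Icc (fun _ : Fin n => (-2:ℝ)) (fun _ => 2) ∧
        ∀ j, |L h j| ≤ 1} = {h : Fin n → ℝ | ∀ j, |L h j| ≤ 1} ∩
          Set.Icc (fun _ : Fin n => (-2:ℝ)) (fun _ => 2) := by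
        ext h; exact and_comm
      rw [this, ← Measure.restrict_apply hEm, ← lintegral_indicator_one hEm]
      rw [VV]
      apply lintegral_congr
      intro h
      by_cases hc : ∀ j, |L h j| ≤ 1
      · rw [Set.indicator_of_mem (show h ∈ {h : Fin n → ℝ | ∀ j, |L h j| ≤ 1} from hc), VV,
          if_pos (show ∀ j, |cur T h Fin.elim0 j| ≤ 1 from hc), Pi.one_apply]
      · rw [Set.indicator_of_notMem (show h ∉ {h : Fin n → ℝ | ∀ j, |L h j| ≤ 1} from hc), VV,
          if_neg (show ¬ ∀ j, |cur T h Fin.elim0 j| ≤ 1 from hc)]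
    rw [h2]
    have h3 : EE 1 T = ∫⁻ h in Set.Icc (fun _ : Fin n => (-1:ℝ)) (fun _ => 1),
      ENNReal.ofReal (∏ j, (max 1 |L h j|)⁻¹) := rfl
    have h4 : n * (0 + 1) = n := by ring
    rw [h4, show EE (0+1) T = EE 1 T from rfl, h3]
    exact h1
  | succ k ih =>
    intro T
    rw [EE, VV]
    calc _ ≤ ∫⁻ h in Set.Icc (fun _ : Fin n => (-1:ℝ)) (fun _ => 1),
          (ENNReal.ofReal (2 ^ (n * (k+1)) / X) + ENNReal.ofReal (Ssum X ^ n) * VV (k+1) (cur T h)) :=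
          lintegral_mono fun h => ih _
      _ = ENNReal.ofReal (2 ^ (n * (k+1)) / X) *
          volume (Set.Icc (fun _ : Fin n => (-1:ℝ)) (fun _ => 1)) + ENNReal.ofReal (Ssum X ^ n) *
          ∫⁻ h in Set.Icc (fun _ : Fin n => (-1:ℝ)) (fun _ => 1), VV (k+1) (cur T h) := by
          rw [lintegral_add_left measurable_const, setLIntegral_const,
            lintegral_const_mul' _ _ ENNReal.ofReal_ne_top]
      _ ≤ _ := by
          gcongr
          · rw [Real.volume_Icc_pi]
            simp only [sub_neg_eq_add, Finset.prod_const, Finset.card_univ, Fintype.card_fin]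
            rw [← ENNReal.ofReal_pow (by norm_num), ← ENNReal.ofReal_mul (by positivity)]
            apply ENNReal.ofReal_le_ofReal
            apply le_of_eq
            norm_num
            ring
          · intro i; norm_num
          · intro i; norm_num

end LogBlock

section Weyl
open scoped ENNReal

lemma eC_add (s t : ℝ) : eC (s + t) = eC s * eC t := by
  rw [eC, eC, eC, ← Complex.exp_add]; congr 1; push_cast; ring

lemma eC_norm (t : ℝ) : ‖eC t‖ = 1 := by
  rw [eC, show 2 * (Real.pi : ℂ) * Complex.I * (t : ℂ) = ((2 * Real.pi * t : ℝ) : ℂ) * Complex.I by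
    push_cast; ring, Complex.norm_exp_ofReal_mul_I]

lemma eC_conj (t : ℝ) : (starRingEnd ℂ) (eC t) = eC (-t) := by
  rw [eC, eC, ← Complex.exp_conj]; congr 1
  simp only [map_mul, Complex.conj_I, Complex.conj_ofReal, Complex.ofReal_neg, map_ofNat]; ring

lemma eC_sum {ι : Type*} (s : Finset ι) (f : ι → ℝ) : eC (∑ i ∈ s, f i) = ∏ i ∈ s, eC (f i) := by
  simp only [eC, ← Complex.exp_sum]; congr 1; push_cast; rw [Finset.mul_sum]

lemma eC_continuous : Continuous eC := by
  unfold eC; fun_prop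

lemma osc_one (v a b : ℝ) (hab : b - a ≤ 1) :
    ‖∫ t in Set.Icc a b, eC (v * t)‖ ≤ (max 1 |v|)⁻¹ := by
  by_cases hle : a ≤ b
  swap
  · rw [Set.Icc_eq_empty hle]; simp
  by_cases hv : |v| ≤ 1
  · rw [max_eq_left hv, inv_one]
    have := norm_setIntegral_le_of_norm_le_const (μ := volume) (s := Set.Icc a b) (f := fun t => eC (v * t)) (C := 1)
      (by simp) (fun t _ => (eC_norm _).le)
    refine this.trans ?_
    rw [one_mul, Real.volume_real_Icc_of_le hle]
    exact hab
  · push Not at hv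
    rw [max_eq_right hv.le, integral_Icc_eq_integral_Ioc, ← intervalIntegral.integral_of_le hle]
    have hv0 : v ≠ 0 := by rintro rfl; simp at hv; linarith
    have hc : (2 * (Real.pi : ℂ) * Complex.I * (v : ℂ)) ≠ 0 := by
      simp [Real.pi_ne_zero, hv0]
    have h1 : ∀ t : ℝ, eC (v * t) = Complex.exp ((2 * (Real.pi : ℂ) * Complex.I * (v : ℂ)) * t) := by
      intro t; rw [eC]; congr 1; push_cast; ring
    simp_rw [h1]
    rw [integral_exp_mul_complex hc, ← h1, ← h1, norm_div]
    have h2 : ‖(2 * (Real.pi : ℂ) * Complex.I * (v : ℂ))‖ = 2 * Real.pi * |v| := by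
      simp [abs_of_pos Real.pi_pos]
    rw [h2, div_le_iff₀ (by positivity)]
    have h3 : ‖eC (v * b) - eC (v * a)‖ ≤ 2 := by
      refine (norm_sub_le _ _).trans ?_
      rw [eC_norm, eC_norm]; norm_num
    have h4 : |v|⁻¹ * (2 * Real.pi * |v|) = 2 * Real.pi := by
      field_simp
    rw [h4]
    linarith [Real.pi_gt_three]

lemma weyl_base {n : ℕ} (F : (Fin n → ℝ) → ℝ) (T : (Fin 0 → Fin n) → Fin n → ℝ) (hF : IsPh 0 F T)
    (a b : Fin n → ℝ) (hab : ∀ j, b j - a j ≤ 1) :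
    ‖∫ ζ in Set.Icc a b, eC (F ζ)‖ₑ ≤ EE 0 T := by
  obtain ⟨c, hc⟩ := hF
  have h1 : ∫ ζ in Set.Icc a b, eC (F ζ) =
      (∏ j, ∫ t in Set.Icc (a j) (b j), eC (T Fin.elim0 j * t)) * eC c := by
    simp_rw [hc, eC_add, eC_sum]
    rw [integral_mul_const]
    congr 1
    rw [← Set.pi_univ_Icc, volume_pi, Measure.restrict_pi_pi]
    exact integral_fintype_prod_eq_prod (fun j t => eC (T Fin.elim0 j * t))
  rw [h1, EE, ← ofReal_norm]
  apply ENNReal.ofReal_le_ofReal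
  rw [norm_mul, eC_norm, mul_one, norm_prod]
  apply Finset.prod_le_prod
  · intro _ _; positivity
  · intro j _; exact osc_one _ _ _ (hab j)

lemma weyl_diff {n : ℕ} (F : (Fin n → ℝ) → ℝ) (hF : Continuous F)
    (a b : Fin n → ℝ) (hab : ∀ j, b j - a j ≤ 1) :
    ∃ J : (Fin n → ℝ) → ℂ, AEStronglyMeasurable J volume ∧
      (∀ h, J h = ∫ ζ in Set.Icc (a ⊔ (a - h)) (b ⊓ (b - h)), eC (F (ζ + h) - F ζ)) ∧
    ‖∫ ζ in Set.Icc a b, eC (F ζ)‖ₑ ^ 2 ≤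
      ∫⁻ h in Set.Icc (fun _ : Fin n => (-1:ℝ)) (fun _ => 1), ‖J h‖ₑ := by
  classical
  have hGc : Continuous fun ζ => eC (F ζ) := eC_continuous.comp hF
  set g : (Fin n → ℝ) → ℂ := (Set.Icc a b).indicator fun ζ => eC (F ζ) with hg
  have hgi : Integrable g := by
    rw [hg, integrable_indicator_iff measurableSet_Icc]
    exact hGc.continuousOn.integrableOn_compact isCompact_Icc
  have hgc : Integrable fun ζ => (starRingEnd ℂ) (g ζ) := by
    exact (RCLike.conjCLE (K := ℂ)).toContinuousLinearMap.integrable_comp hgi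
  let f : (Fin n → ℝ) → (Fin n → ℝ) → ℂ := fun ζ h => (starRingEnd ℂ) (g ζ) * g (ζ + h)
  have hfi : Integrable (Function.uncurry f) (volume.prod volume) := by
    have h1 := hgc.mul_prod hgi
    exact (measurePreserving_prod_add (volume : Measure (Fin n → ℝ)) volume).integrable_comp_of_integrable h1
  have hfv : ∀ ζ h, f ζ h = (Set.Icc (a ⊔ (a - h)) (b ⊓ (b - h))).indicator
      (fun ζ => eC (F (ζ + h) - F ζ)) ζ := by
    intro ζ h
    have hiff : ζ ∈ Set.Icc (a ⊔ (a - h)) (b ⊓ (b - h)) ↔ ζ ∈ Set.Icc a b ∧ ζ + h ∈ Set.Icc a b := by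
      simp only [Set.mem_Icc, sup_le_iff, le_inf_iff, sub_le_iff_le_add, le_sub_iff_add_le]
      tauto
    by_cases h1 : ζ ∈ Set.Icc a b
    · by_cases h2 : ζ + h ∈ Set.Icc a b
      · rw [Set.indicator_of_mem (hiff.mpr ⟨h1, h2⟩)]
        simp only [f, hg]
        rw [Set.indicator_of_mem h1, Set.indicator_of_mem h2, eC_conj, ← eC_add]
        congr 1; ring
      · rw [Set.indicator_of_notMem (fun h => h2 (hiff.mp h).2)]
        simp only [f, hg]
        rw [Set.indicator_of_notMem h2, mul_zero]
    · rw [Set.indicator_of_notMem (fun h => h1 (hiff.mp h).1)]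
      simp only [f, hg]
      rw [Set.indicator_of_notMem h1, map_zero, zero_mul]
  let J : (Fin n → ℝ) → ℂ := fun h => ∫ ζ, f ζ h
  have hJ : ∀ h, J h = ∫ ζ in Set.Icc (a ⊔ (a - h)) (b ⊓ (b - h)), eC (F (ζ + h) - F ζ) := by
    intro h
    simp only [J, hfv]
    rw [integral_indicator measurableSet_Icc]
  have hJ0 : ∀ h, h ∉ Set.Icc (fun _ : Fin n => (-1:ℝ)) (fun _ => 1) → J h = 0 := by
    intro h hh
    rw [hJ, Set.Icc_eq_empty, setIntegral_empty]
    intro hle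
    apply hh
    have h1 : a ≤ b - h := le_sup_left.trans (hle.trans inf_le_right)
    have h2 : a - h ≤ b := le_sup_right.trans (hle.trans inf_le_left)
    constructor
    · intro i
      have := h2 i
      have := hab i
      simp only [Pi.sub_apply] at *
      linarith
    · intro i
      have := h1 i
      have := hab i
      simp only [Pi.sub_apply] at *
      linarith
  refine ⟨J, (hfi.integral_prod_right).aestronglyMeasurable, hJ, ?_⟩
  have hI : ∫ ζ in Set.Icc a b, eC (F ζ) = ∫ ζ, g ζ := by
    rw [hg, integral_indicator measurableSet_Icc]
  have hsq : (starRingEnd ℂ) (∫ ζ, g ζ) * (∫ ζ, g ζ) = ∫ h, J h := by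
    rw [← integral_integral_swap hfi, ← integral_conj, ← integral_mul_const]
    congr 1
    funext ζ
    simp only [f]
    rw [integral_const_mul, integral_add_left_eq_self]
  rw [hI]
  calc ‖∫ ζ, g ζ‖ₑ ^ 2 = ‖(starRingEnd ℂ) (∫ ζ, g ζ) * (∫ ζ, g ζ)‖ₑ := by
        rw [enorm_mul, sq]; congr 1
        rw [← ofReal_norm, ← ofReal_norm, RCLike.norm_conj]
    _ ≤ ∫⁻ h, ‖J h‖ₑ := by rw [hsq]; exact enorm_integral_le_lintegral_enorm _
    _ = _ := by
        rw [← lintegral_indicator measurableSet_Icc]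
        apply lintegral_congr
        intro h
        by_cases hh : h ∈ Set.Icc (fun _ : Fin n => (-1:ℝ)) (fun _ => 1)
        · rw [Set.indicator_of_mem hh]
        · rw [Set.indicator_of_notMem hh, hJ0 h hh]; simp

lemma jensen_pow {α : Type*} [MeasurableSpace α] (μ : Measure α) (J : α → ℂ)
    (hJ : AEStronglyMeasurable J μ) (N : ℕ) (hN : 1 ≤ N) (hμ : 1 ≤ μ Set.univ) :
    (∫⁻ h, ‖J h‖ₑ ∂μ) ^ N ≤ μ Set.univ ^ N * ∫⁻ h, ‖J h‖ₑ ^ N ∂μ := by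
  have hN0 : ((N : NNReal)) ≠ 0 := by exact_mod_cast (by omega : N ≠ 0)
  have h1 := eLpNorm_le_eLpNorm_mul_rpow_measure_univ (μ := μ) (f := J) (p := 1) (q := ((N : NNReal) : ℝ≥0∞))
    (by exact_mod_cast hN) hJ
  have h2 := eLpNorm_nnreal_pow_eq_lintegral (μ := μ) (f := J) hN0
  simp only [NNReal.coe_natCast, ENNReal.rpow_natCast] at h2
  rw [eLpNorm_one_eq_lintegral_enorm] at h1
  calc _ ≤ (eLpNorm J ((N : NNReal) : ℝ≥0∞) μ * μ Set.univ) ^ N := by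
        refine pow_le_pow_left' (h1.trans (mul_le_mul' le_rfl ?_)) N
        calc _ ≤ μ Set.univ ^ (1:ℝ) := by
              apply ENNReal.rpow_le_rpow_of_exponent_le hμ
              simp
          _ = _ := ENNReal.rpow_one _
    _ = _ := by rw [mul_pow, h2, mul_comm]

theorem weyl {n : ℕ} (k : ℕ) : ∃ c : ℝ≥0∞, c ≠ ⊤ ∧ ∀ (F : (Fin n → ℝ) → ℝ)
    (T : (Fin k → Fin n) → Fin n → ℝ), Continuous F → IsPh k F T →
    ∀ a b : Fin n → ℝ, (∀ j, b j - a j ≤ 1) →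
    ‖∫ ζ in Set.Icc a b, eC (F ζ)‖ₑ ^ (2 ^ k) ≤ c * EE k T := by
  induction k with
  | zero =>
    refine ⟨1, ENNReal.one_ne_top, fun F T _ hF a b hab => ?_⟩
    rw [pow_zero, pow_one, one_mul]
    exact weyl_base F T hF a b hab
  | succ k ih =>
    obtain ⟨c, hc, ih⟩ := ih
    have hvol : volume (Set.Icc (fun _ : Fin n => (-1:ℝ)) (fun _ => 1)) = ENNReal.ofReal (2 ^ n) := by
      rw [Real.volume_Icc_pi]
      simp only [sub_neg_eq_add, Finset.prod_const, Finset.card_univ, Fintype.card_fin]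
      rw [← ENNReal.ofReal_pow (by norm_num)]; norm_num
    refine ⟨ENNReal.ofReal (2 ^ n) ^ (2 ^ k) * c,
      ENNReal.mul_ne_top (ENNReal.pow_ne_top ENNReal.ofReal_ne_top) hc, fun F T hFc hF a b hab => ?_⟩
    obtain ⟨J, hJm, hJ, hle⟩ := weyl_diff F hFc a b hab
    rw [show 2 ^ (k+1) = 2 * 2 ^ k by ring, pow_mul, EE]
    set μ := (volume : Measure (Fin n → ℝ)).restrict (Set.Icc (fun _ : Fin n => (-1:ℝ)) (fun _ => 1)) with hμ
    have hμu : μ Set.univ = ENNReal.ofReal (2 ^ n) := by rw [hμ, Measure.restrict_apply_univ, hvol]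
    calc _ ≤ (∫⁻ h, ‖J h‖ₑ ∂μ) ^ (2 ^ k) := pow_le_pow_left' hle _
      _ ≤ μ Set.univ ^ (2 ^ k) * ∫⁻ h, ‖J h‖ₑ ^ (2 ^ k) ∂μ := by
          apply jensen_pow _ _ hJm.restrict _ Nat.one_le_two_pow
          rw [hμu, ← ENNReal.ofReal_one]
          exact ENNReal.ofReal_le_ofReal (one_le_pow₀ (by norm_num))
      _ ≤ μ Set.univ ^ (2 ^ k) * ∫⁻ h, c * EE k (cur T h) ∂μ := by
          refine mul_le_mul' le_rfl (lintegral_mono fun h => ?_)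
          dsimp only
          rw [hJ h]
          apply ih _ _ (by fun_prop) (hF h)
          intro j
          have h1 : (b ⊓ (b - h)) j ≤ b j := inf_le_left
          have h2 : a j ≤ (a ⊔ (a - h)) j := le_sup_left
          have := hab j
          linarith
      _ = _ := by rw [lintegral_const_mul' _ _ hc, hμu, mul_assoc]

end Weyl

section Tail

theorem tail_bound (R : ℕ) (s : ℝ) (hs : (R:ℝ) < s) : ∃ c : ℝ, 0 < c ∧
    ∀ G : (Fin R → ℝ) → ℂ, Continuous G → ∀ Q : ℝ, 0 ≤ Q →
    (∀ γ, γ ≠ 0 → ‖G γ‖ ≤ Q * ‖γ‖ ^ (-s)) → ∃ L : ℂ, ∀ Φ : ℝ, 0 < Φ →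
    ‖L - ∫ γ in {γ : Fin R → ℝ | ∀ i, |γ i| ≤ Φ}, G γ‖ ≤ c * Q * Φ ^ ((R:ℝ) - s) := by
  have hs0 : 0 < s := lt_of_le_of_lt (by positivity) hs
  let S : ℝ → Set (Fin R → ℝ) := fun Φ => {γ | Φ < ‖γ‖}
  have hSm : ∀ Φ, MeasurableSet (S Φ) := fun Φ => (isOpen_lt continuous_const continuous_norm).measurableSet
  have hmeas : Measurable fun γ : Fin R → ℝ => ‖γ‖ ^ (-s) := measurable_norm.pow_const _
  have hi1 : IntegrableOn (fun γ : Fin R → ℝ => ‖γ‖ ^ (-s)) (S 1) := by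
    have h1 : Integrable fun γ : Fin R → ℝ => (2:ℝ) ^ s * (1 + ‖γ‖) ^ (-s) :=
      (integrable_one_add_norm (by simpa using hs)).const_mul _
    refine Integrable.mono' h1.integrableOn hmeas.aestronglyMeasurable ?_
    refine (ae_restrict_iff' (hSm 1)).mpr (Eventually.of_forall fun γ hγ => ?_)
    have hγ1 : 1 < ‖γ‖ := hγ
    rw [Real.norm_of_nonneg (by positivity), Real.rpow_neg (by positivity), Real.rpow_neg (by positivity),
      ← div_eq_mul_inv, ← Real.div_rpow (by norm_num) (by positivity), ← Real.inv_rpow (by positivity)]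
    apply Real.rpow_le_rpow (by positivity) _ hs0.le
    rw [inv_eq_one_div, div_le_div_iff₀ (by positivity) (by positivity)]
    linarith
  have hsc : ∀ Φ, 0 < Φ → ∀ γ : Fin R → ℝ, (S Φ).indicator (fun γ => ‖γ‖ ^ (-s)) γ =
      Φ ^ (-s) * (S 1).indicator (fun γ => ‖γ‖ ^ (-s)) (Φ⁻¹ • γ) := by
    intro Φ hΦ γ
    have hn : ‖Φ⁻¹ • γ‖ = Φ⁻¹ * ‖γ‖ := by
      rw [norm_smul, Real.norm_of_nonneg (by positivity)]
    have hiff : Φ⁻¹ • γ ∈ S 1 ↔ γ ∈ S Φ := by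
      change 1 < ‖Φ⁻¹ • γ‖ ↔ Φ < ‖γ‖
      rw [hn, ← div_eq_inv_mul, one_lt_div hΦ]
    by_cases h : γ ∈ S Φ
    · rw [Set.indicator_of_mem h, Set.indicator_of_mem (hiff.mpr h), hn,
        ← Real.mul_rpow hΦ.le (by positivity), mul_inv_cancel_left₀ hΦ.ne']
    · rw [Set.indicator_of_notMem h, Set.indicator_of_notMem (fun h' => h (hiff.mp h')), mul_zero]
  set c0 := ∫ γ in S 1, ‖γ‖ ^ (-s) with hc0
  have hc00 : 0 ≤ c0 := integral_nonneg fun γ => by positivity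
  have hiPhi : ∀ Φ, 0 < Φ → IntegrableOn (fun γ : Fin R → ℝ => ‖γ‖ ^ (-s)) (S Φ) := by
    intro Φ hΦ
    rw [← integrable_indicator_iff (hSm Φ)]
    have h1 := (integrable_indicator_iff (hSm 1)).mpr hi1
    have h2 := (integrable_comp_smul_iff volume _ (inv_ne_zero hΦ.ne')).mpr h1
    refine (h2.const_mul (Φ ^ (-s))).congr (Eventually.of_forall fun γ => ?_)
    exact (hsc Φ hΦ γ).symm
  have hval : ∀ Φ, 0 < Φ → ∫ γ in S Φ, ‖γ‖ ^ (-s) = c0 * Φ ^ ((R:ℝ) - s) := by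
    intro Φ hΦ
    rw [← integral_indicator (hSm Φ)]
    simp_rw [hsc Φ hΦ]
    rw [integral_const_mul, Measure.integral_comp_smul volume, integral_indicator (hSm 1), ← hc0]
    simp only [Module.finrank_fintype_fun_eq_card, Fintype.card_fin, inv_pow, inv_inv, smul_eq_mul]
    rw [abs_of_pos (by positivity), sub_eq_add_neg, Real.rpow_add hΦ, Real.rpow_natCast]
    ring
  refine ⟨c0 + 1, by positivity, fun G hG Q hQ hGQ => ?_⟩
  have hGS : ∀ Φ, 0 < Φ → IntegrableOn G (S Φ) := by
    intro Φ hΦ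
    refine Integrable.mono' ((hiPhi Φ hΦ).const_mul Q) hG.aestronglyMeasurable ?_
    refine (ae_restrict_iff' (hSm Φ)).mpr (Eventually.of_forall fun γ hγ => ?_)
    apply hGQ
    rintro rfl
    have : Φ < ‖(0 : Fin R → ℝ)‖ := hγ
    rw [norm_zero] at this
    linarith
  refine ⟨∫ γ, G γ, fun Φ hΦ => ?_⟩
  have hset : {γ : Fin R → ℝ | ∀ i, |γ i| ≤ Φ} = (S Φ)ᶜ := by
    ext γ
    change (∀ i, |γ i| ≤ Φ) ↔ ¬ Φ < ‖γ‖
    rw [not_lt, pi_norm_le_iff_of_nonneg hΦ.le]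
    rfl
  have hball : (S Φ)ᶜ = Metric.closedBall 0 Φ := by
    ext γ
    rw [mem_closedBall_zero_iff]
    exact not_lt (a := Φ) (b := ‖γ‖)
  have hGi : Integrable G := by
    rw [← integrableOn_univ, ← Set.union_compl_self (S Φ)]
    refine (hGS Φ hΦ).union ?_
    rw [hball]
    exact hG.continuousOn.integrableOn_compact (isCompact_closedBall _ _)
  rw [hset, ← integral_add_compl (hSm Φ) hGi, add_sub_cancel_right]
  calc ‖∫ γ in S Φ, G γ‖ ≤ ∫ γ in S Φ, Q * ‖γ‖ ^ (-s) := by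
        apply norm_integral_le_of_norm_le ((hiPhi Φ hΦ).const_mul Q)
        refine (ae_restrict_iff' (hSm Φ)).mpr (Eventually.of_forall fun γ hγ => ?_)
        apply hGQ
        rintro rfl
        have : Φ < ‖(0 : Fin R → ℝ)‖ := hγ
        rw [norm_zero] at this
        linarith
    _ = Q * (c0 * Φ ^ ((R:ℝ) - s)) := by rw [integral_const_mul, hval Φ hΦ]
    _ ≤ _ := by
        have : 0 ≤ Q * Φ ^ ((R:ℝ) - s) := by positivity
        nlinarith

end Tail

lemma real_opt (c1 c2 : ℝ) (hc1 : 0 < c1) (hc2 : 0 < c2) (n R k : ℕ) (hn : 0 < n) (hR : 0 < R) (hk : 0 < k)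
    (D σ : ℝ) (hD : 0 < D) (hσ : 0 < σ) (hs : σ < D / (R * k)) :
    ∃ c3 : ℝ, 0 < c3 ∧ ∀ T : ℝ, 2 * c1 + 1 ≤ T → ∃ H X : ℕ, 1 ≤ H ∧ 1 ≤ X ∧
      c1 * (H:ℝ) ^ (k * R) < T ∧
      2 ^ (n * k) / (X:ℝ) + Ssum X ^ n * (c2 * (H:ℝ) ^ (-D)) ≤ c3 * T ^ (-σ) := by
  have hn' : (0:ℝ) < n := by exact_mod_cast hn
  have hR' : (0:ℝ) < R := by exact_mod_cast hR
  have hk' : (0:ℝ) < k := by exact_mod_cast hk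
  set e := D / (R * k) with he
  set ε := (e - σ) / (n * σ) with hε
  have hε0 : 0 < ε := div_pos (by linarith) (by positivity)
  obtain ⟨c0, hc0, hS⟩ := Ssum_le ε hε0
  refine ⟨2 ^ (n * k) + (c0 * 2 ^ ε) ^ n * (c2 * (2 ^ D * (2 * c1) ^ e)), by positivity, fun T hT => ?_⟩
  have hT1 : 1 ≤ T := by linarith
  have hT0 : 0 < T := by linarith
  set w := T / (2 * c1) with hw
  have hw1 : 1 ≤ w := by rw [hw, one_le_div (by positivity)]; linarith
  set y := w ^ (1 / ((R:ℝ) * k)) with hy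
  have hy1 : 1 ≤ y := Real.one_le_rpow hw1 (by positivity)
  have hy0 : 0 < y := by linarith
  set z := T ^ σ with hz
  have hz1 : 1 ≤ z := Real.one_le_rpow hT1 hσ.le
  have hH1 : 1 ≤ ⌊y⌋₊ := Nat.one_le_floor_iff _ |>.mpr hy1
  have hX1 : 1 ≤ ⌈z⌉₊ := Nat.one_le_ceil_iff.mpr (by linarith)
  refine ⟨⌊y⌋₊, ⌈z⌉₊, hH1, hX1, ?_, ?_⟩
  · have h1 : (⌊y⌋₊ : ℝ) ^ (k * R) ≤ w := by
      calc (⌊y⌋₊ : ℝ) ^ (k * R) ≤ y ^ (k * R) := by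
            gcongr; exact Nat.floor_le hy0.le
        _ = w := by
            rw [hy, ← Real.rpow_natCast, ← Real.rpow_mul (by linarith)]
            push_cast
            rw [show 1 / ((R:ℝ) * k) * (k * R) = 1 by field_simp, Real.rpow_one]
    calc c1 * (⌊y⌋₊ : ℝ) ^ (k * R) ≤ c1 * w := by gcongr
      _ = T / 2 := by rw [hw]; field_simp
      _ < T := by linarith
  · set H : ℝ := (⌊y⌋₊ : ℝ)
    set X : ℝ := (⌈z⌉₊ : ℝ)
    have hHy : y / 2 ≤ H := by
      have h1 := Nat.lt_floor_add_one y
      have h2 : (1:ℝ) ≤ H := by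
        change (1:ℝ) ≤ ((⌊y⌋₊ : ℕ) : ℝ)
        exact_mod_cast hH1
      change y < H + 1 at h1
      linarith
    have hXz : z ≤ X := Nat.le_ceil z
    have hXz2 : X ≤ 2 * z := by
      have := Nat.ceil_lt_add_one (by linarith : 0 ≤ z)
      change X < z + 1 at this
      linarith
    have hA : 2 ^ (n * k) / X ≤ 2 ^ (n * k) * T ^ (-σ) := by
      rw [Real.rpow_neg hT0.le, ← hz, ← div_eq_mul_inv]
      gcongr
    have hB : H ^ (-D) ≤ 2 ^ D * (2 * c1) ^ e * T ^ (-e) := by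
      calc H ^ (-D) ≤ (y / 2) ^ (-D) := Real.rpow_le_rpow_of_nonpos (by positivity) hHy (by linarith)
        _ = 2 ^ D * y ^ (-D) := by
            rw [Real.div_rpow hy0.le (by norm_num), Real.rpow_neg (by norm_num : (0:ℝ) ≤ 2)]
            field_simp
        _ = 2 ^ D * w ^ (-e) := by
            rw [hy, ← Real.rpow_mul (by linarith)]
            congr 2
            rw [he]; field_simp
        _ = _ := by
            rw [hw, Real.div_rpow hT0.le (by positivity), Real.rpow_neg (by positivity : (0:ℝ) ≤ 2 * c1)]
            field_simp
    have hC : Ssum ⌈z⌉₊ ^ n ≤ (c0 * 2 ^ ε) ^ n * T ^ (e - σ) := by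
      calc Ssum ⌈z⌉₊ ^ n ≤ (c0 * X ^ ε) ^ n := by
            apply pow_le_pow_left₀ (Ssum_nonneg _) (hS _ hX1)
        _ ≤ (c0 * (2 * z) ^ ε) ^ n := by gcongr
        _ = _ := by
            rw [Real.mul_rpow (by norm_num) (by linarith), ← mul_assoc, mul_pow]
            congr 1
            rw [hz, ← Real.rpow_mul hT0.le, ← Real.rpow_natCast, ← Real.rpow_mul hT0.le]
            congr 1
            rw [hε]; field_simp
    have hH0 : 0 < H := by linarith [half_pos hy0]
    calc _ ≤ 2 ^ (n * k) * T ^ (-σ) + ((c0 * 2 ^ ε) ^ n * T ^ (e - σ)) *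
          (c2 * (2 ^ D * (2 * c1) ^ e * T ^ (-e))) := by
          have := Ssum_nonneg ⌈z⌉₊
          gcongr
      _ = _ := by
          have : T ^ (-σ) = T ^ (e - σ) * T ^ (-e) := by
            rw [← Real.rpow_add hT0]; congr 1; ring
          rw [this]; ring

section Assemble
open scoped ENNReal

lemma Iosc_continuous {n R : ℕ} (g : Fin R → MvPolynomial (Fin n) ℤ) (a b : Fin n → ℝ) :
    Continuous (Iosc g (boxSet a b)) := by
  have hb : boxSet a b = Set.Icc a b := Set.pi_univ_Icc a b
  have haev : ∀ i, Continuous fun ζ : Fin n → ℝ => aeval ζ (g i) := fun i => by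
    simp_rw [aeval_def, eval₂_eq_eval_map]
    exact MvPolynomial.continuous_eval _
  unfold Iosc
  rw [hb]
  refine continuous_of_dominated (bound := fun _ => 1) ?_ ?_ ?_ ?_
  · intro γ
    refine (eC_continuous.comp ?_).aestronglyMeasurable
    exact continuous_finsetSum _ fun i _ => continuous_const.mul (haev i)
  · intro γ
    exact Eventually.of_forall fun ζ => (eC_norm _).le
  · have : IntegrableOn (fun _ : Fin n → ℝ => (1:ℝ)) (Set.Icc a b) :=
      continuousOn_const.integrableOn_compact isCompact_Icc
    exact this
  · refine Eventually.of_forall fun ζ => eC_continuous.comp ?_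
    exact continuous_finsetSum _ fun i _ => (continuous_apply i).mul continuous_const

lemma Iosc_le_one {n R : ℕ} (g : Fin R → MvPolynomial (Fin n) ℤ) (a b : Fin n → ℝ)
    (h0 : ∀ j, a j ≤ b j) (h1 : ∀ j, b j - a j ≤ 1) (γ : Fin R → ℝ) :
    ‖Iosc g (boxSet a b) γ‖ ≤ 1 := by
  have hb : boxSet a b = Set.Icc a b := Set.pi_univ_Icc a b
  rw [Iosc, hb]
  have hv : (volume (Set.Icc a b)) ≤ 1 := by
    rw [Real.volume_Icc_pi]
    apply Finset.prod_le_one'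
    intro j _
    rw [← ENNReal.ofReal_one]
    exact ENNReal.ofReal_le_ofReal (h1 j)
  have := norm_setIntegral_le_of_norm_le_const (μ := volume) (s := Set.Icc a b)
    (f := fun ζ => eC (∑ i, γ i * aeval ζ (g i))) (C := 1)
      (hv.trans_lt ENNReal.one_lt_top) (fun t _ => (eC_norm _).le)
  refine this.trans ?_
  rw [one_mul, Measure.real]
  exact ENNReal.toReal_le_of_le_ofReal zero_le_one (by simpa using hv)

theorem osc_decay (F : Type*) [Field F] [CharZero F] (n R κ Δ : ℕ) (hR : 0 < R) (s : ℝ) (hs0 : 0 < s)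
    (hs : 2 ^ (κ+1) * s < ((n:ℝ) - Δ) / (R * ((κ+1 : ℕ) : ℝ))) :
    ∃ c : ℝ, 0 < c ∧ ∀ g : Fin R → MvPolynomial (Fin n) ℤ,
      (∀ i, (g i).IsHomogeneous (κ+2)) → ∀ Cv : ℝ, 1 ≤ Cv →
      (∀ i β, |((coeff β (g i) : ℤ) : ℝ)| ≤ Cv) →
      (∀ b : Fin R → ℤ, b ≠ 0 → ringKrullDim (MvPolynomial (Fin n) F ⧸
        Ideal.span (Set.range fun j : Fin n => pderiv j
          (map (Int.castRingHom F) (∑ i, b i • g i)))) ≤ (Δ : WithBot ℕ∞)) →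
      ∀ a b : Fin n → ℝ, (∀ j, a j ≤ b j) → (∀ j, b j - a j ≤ 1) →
      ∀ γ : Fin R → ℝ, γ ≠ 0 →
      ‖Iosc g (boxSet a b) γ‖ ≤ c * (Cv ^ (R-1)) ^ s * ‖γ‖ ^ (-s) := by
  have hσ0 : 0 < 2 ^ (κ+1) * s := by positivity
  have hR' : (0:ℝ) < R := by exact_mod_cast hR
  have hD : 0 < (n:ℝ) - Δ := by
    by_contra hcon
    have : ((n:ℝ) - Δ) / (R * ((κ+1 : ℕ) : ℝ)) ≤ 0 :=
      div_nonpos_of_nonpos_of_nonneg (not_lt.mp hcon) (by positivity)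
    linarith
  have hΔn : Δ < n := by
    have : (Δ:ℝ) < n := by linarith
    exact_mod_cast this
  obtain ⟨c1, c2, hc1, hc2, hcount⟩ := count_final F n R κ Δ
  obtain ⟨c3, hc3, hopt⟩ := real_opt c1 c2 hc1 hc2 n R (κ+1) (by omega) hR (by omega)
    ((n:ℝ) - Δ) (2 ^ (κ+1) * s) hD hσ0 hs
  obtain ⟨cw, hcw, hweyl⟩ := weyl (n := n) (κ+1)
  set M := cw.toReal * c3 + 1 with hM
  have hM1 : 1 ≤ M := by
    have : 0 ≤ cw.toReal * c3 := by positivity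
    linarith
  refine ⟨max M ((2 * c1 + 1) ^ s), by positivity, fun g hg Cv hCv hco hdim a b hab0 hab γ hγ => ?_⟩
  have hγ0 : 0 < ‖γ‖ := norm_pos_iff.mpr hγ
  have hCp : 0 < Cv ^ (R-1) := by positivity
  set T := ‖γ‖ / Cv ^ (R-1) with hT
  have hT0 : 0 < T := by positivity
  have hTs : T ^ (-s) = (Cv ^ (R-1)) ^ s * ‖γ‖ ^ (-s) := by
    rw [hT, Real.div_rpow hγ0.le hCp.le, Real.rpow_neg hCp.le, div_inv_eq_mul, mul_comm]
  rw [mul_assoc, ← hTs]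
  have hTs0 : 0 < T ^ (-s) := by positivity
  by_cases hbig : 2 * c1 + 1 ≤ T
  swap
  · push Not at hbig
    calc _ ≤ 1 := Iosc_le_one g a b hab0 hab γ
      _ = T ^ s * T ^ (-s) := by rw [← Real.rpow_add hT0]; simp
      _ ≤ (2 * c1 + 1) ^ s * T ^ (-s) := by gcongr
      _ ≤ _ := by gcongr; exact le_max_right _ _
  · obtain ⟨H, X, hH, hX, hHT, hle⟩ := hopt T hbig
    have hHpos : (0:ℝ) < H := by exact_mod_cast hH
    set Tn : (Fin (κ+1) → Fin n) → Fin n → ℝ :=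
      fun s j => ∑ i, γ i * ((tens (κ+1) (g i) s j : ℤ) : ℝ) with hTn
    set p : MvPolynomial (Fin n) ℝ := ∑ i, C (γ i) * map (Int.castRingHom ℝ) (g i) with hp
    have hpT : tens (κ+1) p = Tn := by
      funext s j
      rw [hp, tens_sum]
      apply Finset.sum_congr rfl
      intro i _
      rw [tens_C_mul, tens_map]
      rfl
    have hph : IsPh (κ+1) (fun ζ => eval ζ p) Tn := by
      rw [← hpT]
      apply isPh_tens
      apply DL.sum
      intro i _
      apply DL.C_mul
      exact DL_of_hom ((hg i).map _)
    have hI : Iosc g (boxSet a b) γ = ∫ ζ in Set.Icc a b, eC (eval ζ p) := by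
      rw [Iosc, show boxSet a b = Set.Icc a b from Set.pi_univ_Icc a b]
      congr 1
      funext ζ
      congr 1
      rw [hp, map_sum]
      apply Finset.sum_congr rfl
      intro i _
      rw [map_mul, eval_C, aeval_def, eval₂_eq_eval_map]
      rfl
    have hcnt := hcount g hg Cv hCv hco hdim γ H hH (by
      rw [hT, lt_div_iff₀ hCp] at hHT
      calc _ = c1 * (H:ℝ) ^ ((κ+1) * R) * Cv ^ (R-1) := by ring
        _ < _ := hHT)
    have hVV : VV (κ+1) Tn ≤ ENNReal.ofReal (c2 * (H:ℝ) ^ (-((n:ℝ) - Δ))) := by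
      refine (VV_le_count H hH (κ+1) Tn).trans ?_
      rw [← ENNReal.ofReal_natCast, ← ENNReal.ofReal_mul (by positivity)]
      apply ENNReal.ofReal_le_ofReal
      calc _ ≤ ((H:ℝ) ^ (n * (κ+1)))⁻¹ * (c2 * (H:ℝ) ^ (n * κ + Δ)) := by gcongr
        _ = _ := by
          rw [neg_sub, Real.rpow_sub hHpos, Real.rpow_natCast, Real.rpow_natCast]
          field_simp
          ring
    have hEE : EE (κ+1) Tn ≤ ENNReal.ofReal (c3 * T ^ (-(2 ^ (κ+1) * s))) := by
      calc _ ≤ ENNReal.ofReal (2 ^ (n * (κ+1)) / X) + ENNReal.ofReal (Ssum X ^ n) * VV (κ+1) Tn :=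
            EE_le X hX κ Tn
        _ ≤ ENNReal.ofReal (2 ^ (n * (κ+1)) / X) + ENNReal.ofReal (Ssum X ^ n) *
            ENNReal.ofReal (c2 * (H:ℝ) ^ (-((n:ℝ) - Δ))) :=
            add_le_add le_rfl (mul_le_mul' le_rfl hVV)
        _ = ENNReal.ofReal (2 ^ (n * (κ+1)) / X + Ssum X ^ n * (c2 * (H:ℝ) ^ (-((n:ℝ) - Δ)))) := by
            have := Ssum_nonneg X
            rw [← ENNReal.ofReal_mul (by positivity), ← ENNReal.ofReal_add (by positivity) (by positivity)]
        _ ≤ _ := ENNReal.ofReal_le_ofReal hle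
    have hW := hweyl (fun ζ => eval ζ p) Tn (MvPolynomial.continuous_eval p) hph a b hab
    rw [← hI] at hW
    have hW2 : ‖Iosc g (boxSet a b) γ‖ ^ (2 ^ (κ+1)) ≤ cw.toReal * (c3 * T ^ (-(2 ^ (κ+1) * s))) := by
      have h1 := hW.trans (mul_le_mul' le_rfl hEE)
      rw [← ENNReal.ofReal_toReal hcw, ← ENNReal.ofReal_mul ENNReal.toReal_nonneg, ← ofReal_norm,
        ← ENNReal.ofReal_pow (norm_nonneg _)] at h1
      rwa [ENNReal.ofReal_le_ofReal_iff (by positivity)] at h1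
    have hW3 : ‖Iosc g (boxSet a b) γ‖ ^ (2 ^ (κ+1)) ≤ (M * T ^ (-s)) ^ (2 ^ (κ+1)) := by
      refine hW2.trans ?_
      have hpw : (T ^ (-s)) ^ (2 ^ (κ+1)) = T ^ (-(2 ^ (κ+1) * s)) := by
        rw [← Real.rpow_natCast, ← Real.rpow_mul hT0.le]
        congr 1; push_cast; ring
      rw [mul_pow, hpw, ← mul_assoc]
      gcongr
      calc cw.toReal * c3 ≤ M := by linarith
        _ ≤ M ^ (2 ^ (κ+1)) := le_self_pow₀ hM1 (by positivity)
    have hW4 := le_of_pow_le_pow_left₀ (by positivity) (by positivity) hW3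
    refine hW4.trans ?_
    gcongr; exact le_max_left _ _

end Assemble

/-- **Lemma 2.12 (convergence of the singular integral, with rate).** -/
theorem singular_integral_convergence (n R d : ℕ) (hR : 0 < R) (hd : 2 ≤ d) (hnR : R < n)
    (η δ : ℝ) (hη : 0 < η) (hδ : 0 < δ) :
    ∃ c : ℝ, 0 < c ∧
      ∀ (f : Fin R → MvPolynomial (Fin n) ℤ),
        (∀ i, (f i).totalDegree = d) →
        ∀ (aB bB : Fin n → ℝ),
        (∀ j, -1 ≤ aB j ∧ 0 < bB j - aB j ∧ bB j - aB j < 1 ∧ bB j ≤ 1) →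
        ∀ Ct K : ℝ, 1 ≤ Ct →
        coeffMax (fun i => MvPolynomial.homogeneousComponent d (f i)) Ct →
        KofDelta n R d (fun i => MvPolynomial.homogeneousComponent d (f i)) K →
        δ / η < K / ((R : ℝ) * ((d : ℝ) - 1)) - ((R : ℝ) + 1) →
        ∀ μ : Fin R → ℝ, ∃ L : ℂ,
          Filter.Tendsto
            (fun Φ : ℝ => Jint (fun i => MvPolynomial.homogeneousComponent d (f i)) aB bB μ Φ)
            Filter.atTop (nhds L) ∧
          ∀ Φ : ℝ, 0 < Φ →
            ‖L - Jint (fun i => MvPolynomial.homogeneousComponent d (f i)) aB bB μ Φ‖ ≤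
              c * Ct ^ ((R : ℝ) ^ 2 - 1 + ((R : ℝ) - 1) * δ / η) * Φ ^ (-1 - δ / η) := by
  obtain ⟨κ, rfl⟩ : ∃ κ, d = κ + 2 := ⟨d - 2, by omega⟩
  have hR' : (0:ℝ) < R := by exact_mod_cast hR
  have hq : 0 < δ / η := div_pos hδ hη
  set s : ℝ := (R:ℝ) + 1 + δ / η with hs
  have hs0 : 0 < s := by positivity
  have hsR : (R:ℝ) < s := by linarith
  obtain ⟨ct, hct, htail⟩ := tail_bound R s hsR
  have hdec : ∀ Δ : ℕ, ∃ c : ℝ, 0 < c ∧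
      (2 ^ (κ+1) * s < ((n:ℝ) - Δ) / (R * ((κ+1 : ℕ) : ℝ)) →
      ∀ g : Fin R → MvPolynomial (Fin n) ℤ,
      (∀ i, (g i).IsHomogeneous (κ+2)) → ∀ Cv : ℝ, 1 ≤ Cv →
      (∀ i β, |((coeff β (g i) : ℤ) : ℝ)| ≤ Cv) →
      (∀ b : Fin R → ℤ, b ≠ 0 → ringKrullDim (MvPolynomial (Fin n) Qbar ⧸
        Ideal.span (Set.range fun j : Fin n => pderiv j
          (map (Int.castRingHom Qbar) (∑ i, b i • g i)))) ≤ (Δ : WithBot ℕ∞)) →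
      ∀ a b : Fin n → ℝ, (∀ j, a j ≤ b j) → (∀ j, b j - a j ≤ 1) →
      ∀ γ : Fin R → ℝ, γ ≠ 0 →
      ‖Iosc g (boxSet a b) γ‖ ≤ c * (Cv ^ (R-1)) ^ s * ‖γ‖ ^ (-s)) := by
    intro Δ
    by_cases hc : 2 ^ (κ+1) * s < ((n:ℝ) - Δ) / (R * ((κ+1 : ℕ) : ℝ))
    · obtain ⟨c, hc0, h⟩ := osc_decay Qbar n R κ Δ hR s hs0 hc
      exact ⟨c, hc0, fun _ => h⟩
    · exact ⟨1, one_pos, fun h => absurd h hc⟩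
  choose cD hcD0 hcD using hdec
  set cm := ∑ Δ ∈ Finset.range (n+1), cD Δ with hcm
  have hcm0 : 0 < cm := Finset.sum_pos (fun Δ _ => hcD0 Δ) ⟨0, by simp⟩
  refine ⟨ct * cm, by positivity, ?_⟩
  intro f _ aB bB hbox Ct K hCt hmax hK hgap μ
  obtain ⟨Δ, hΔ, rfl⟩ := hK
  set g : Fin R → MvPolynomial (Fin n) ℤ := fun i => homogeneousComponent (κ+2) (f i) with hg
  have hCt0 : 0 < Ct := by linarith
  have hcond : 2 ^ (κ+1) * s < ((n:ℝ) - Δ) / (R * ((κ+1 : ℕ) : ℝ)) := by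
    have h1 : s < ((n:ℝ) - Δ) / 2 ^ (κ+1) / (R * ((κ+1 : ℕ) : ℝ)) := by
      have h2 : (((κ + 2 : ℕ) : ℝ) - 1) = ((κ+1 : ℕ) : ℝ) := by push_cast; ring
      rw [h2] at hgap
      have h3 : κ + 2 - 1 = κ + 1 := by omega
      rw [h3] at hgap
      linarith
    rw [div_right_comm, lt_div_iff₀ (by positivity)] at h1
    linarith
  have hΔn : Δ ∈ Finset.range (n+1) := by
    rw [Finset.mem_range]
    by_contra hcon
    have h1 : (n:ℝ) ≤ Δ := by exact_mod_cast (by omega : n ≤ Δ)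
    have : ((n:ℝ) - Δ) / (R * ((κ+1 : ℕ) : ℝ)) ≤ 0 :=
      div_nonpos_of_nonpos_of_nonneg (by linarith) (by positivity)
    have : 0 < 2 ^ (κ+1) * s := by positivity
    linarith
  have hcle : cD Δ ≤ cm := Finset.single_le_sum (fun i _ => (hcD0 i).le) hΔn
  have hbd := hcD Δ hcond g (fun i => homogeneousComponent_isHomogeneous _ _) Ct hCt
    (fun i β => hmax.2 ⟨i, β, rfl⟩)
    (fun b hb => by
      have h1 : singDim n (map (Int.castRingHom Qbar) (∑ i, b i • g i)) ≤ birchDelta n R g :=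
        le_iSup₂ (f := fun (b : Fin R → ℤ) (_ : b ≠ 0) =>
          singDim n (map (Int.castRingHom Qbar) (∑ i, b i • g i))) b hb
      rw [← hΔ] at h1
      exact h1)
    aB bB (fun j => by linarith [(hbox j).2.1]) (fun j => (hbox j).2.2.1.le)
  set Q : ℝ := cm * (Ct ^ (R-1)) ^ s with hQ
  have hQ0 : 0 ≤ Q := by positivity
  obtain ⟨L, hL⟩ := htail (fun γ => Iosc g (boxSet aB bB) γ * eC (-(∑ i, γ i * μ i)))
    ((Iosc_continuous g aB bB).mul (eC_continuous.comp (by fun_prop))) Q hQ0 (by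
      intro γ hγ
      rw [norm_mul, eC_norm, mul_one]
      refine (hbd γ hγ).trans ?_
      rw [hQ]
      gcongr)
  have hCexp : (Ct ^ (R-1)) ^ s = Ct ^ ((R:ℝ) ^ 2 - 1 + ((R:ℝ) - 1) * δ / η) := by
    rw [← Real.rpow_natCast, ← Real.rpow_mul hCt0.le]
    congr 1
    rw [Nat.cast_sub hR, hs]
    push_cast
    ring
  have hΦexp : (R:ℝ) - s = -1 - δ / η := by rw [hs]; ring
  have hfin : ∀ Φ : ℝ, 0 < Φ → ‖L - Jint g aB bB μ Φ‖ ≤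
      ct * cm * Ct ^ ((R:ℝ) ^ 2 - 1 + ((R:ℝ) - 1) * δ / η) * Φ ^ (-1 - δ / η) := by
    intro Φ hΦ
    have h1 := hL Φ hΦ
    rw [hQ, hCexp, hΦexp] at h1
    rw [mul_assoc ct cm]
    exact h1
  refine ⟨L, ?_, hfin⟩
  rw [tendsto_iff_norm_sub_tendsto_zero]
  have hz : Tendsto (fun Φ : ℝ => ct * cm * Ct ^ ((R:ℝ) ^ 2 - 1 + ((R:ℝ) - 1) * δ / η) *
      Φ ^ (-1 - δ / η)) atTop (nhds 0) := by
    have h1 : Tendsto (fun Φ : ℝ => Φ ^ (-(1 + δ / η))) atTop (nhds 0) :=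
      tendsto_rpow_neg_atTop (by positivity)
    have h2 := h1.const_mul (ct * cm * Ct ^ ((R:ℝ) ^ 2 - 1 + ((R:ℝ) - 1) * δ / η))
    rw [mul_zero] at h2
    rwa [show -(1 + δ / η) = -1 - δ / η by ring] at h2
  refine squeeze_zero' (Eventually.of_forall fun Φ => norm_nonneg _) ?_ hz
  filter_upwards [eventually_gt_atTop 0] with Φ hΦ
  rw [norm_sub_rev]
  exact hfin Φ hΦ

end
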